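/- arXiv:2507.04254 — 3 statements merged into one kernel-verified Lean document; each statement's English description precedes it below -/
import Mathlib

section
/- Let r and k be positive odd integers with 0 < k < r. Then every finite simple r-regular graph contains a k-regular subgraph with non-empty vertex set, provided the graph itself has non-empty vertex set. -/
section RegularSubgraph

open Finset

/-- A weighted form of Tutte's theorem. A graph on an even number of vertices has a perfect matching
if its edges carry weights of total at most `N` at every vertex such that the cut of every odd set
of vertices has weight at least `N`, up to a defect `μ` of total less than `2 * N`. -/
theorem exists_isPerfectMatching_of_weight {V : Type*} [Fintype V] [DecidableEq V]
    (G : SimpleGraph V) (hV : Even (Fintype.card V)) (x : V → V → ℕ) (μ : V → ℕ) (N : ℕ)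
    (hadj : ∀ u w, x u w ≠ 0 → G.Adj u w) (hx : ∀ w, ∑ u, x u w ≤ N) (hμ : ∑ u, μ u < 2 * N)
    (hcut : ∀ W : Finset V, Odd #W → N ≤ ∑ u ∈ W, ∑ w ∈ Wᶜ, x u w + ∑ u ∈ W, μ u) :
    ∃ M : G.Subgraph, M.IsPerfectMatching := by
  classical
  rw [SimpleGraph.tutte]
  intro U hU
  rw [SimpleGraph.IsTutteViolator] at hU
  set H := ((⊤ : G.Subgraph).deleteVerts U).coe with hH
  have hpar := H.odd_ncard_oddComponents
  have hverts : Nat.card ((⊤ : G.Subgraph).deleteVerts U).verts + U.ncard = Fintype.card V := by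
    rw [Nat.card_coe_set_eq, SimpleGraph.Subgraph.deleteVerts_verts, SimpleGraph.Subgraph.verts_top,
      ← Set.compl_eq_univ_sdiff, add_comm, Set.ncard_add_ncard_compl, Nat.card_eq_fintype_card]
  set f : V → ℕ := fun u => ∑ w ∈ U.toFinset, x u w + μ u with hf
  set comp : H.ConnectedComponent → Finset V := fun c => (Subtype.val '' c.supp).toFinset with hcomp
  have hodd (c) (hc : c ∈ H.oddComponents.toFinset) : N ≤ ∑ u ∈ comp c, f u := by
    have hc' : Odd #(comp c) := by
      rw [hcomp, ← Set.ncard_eq_toFinset_card',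
        Set.ncard_image_of_injective _ Subtype.val_injective]
      simpa using hc
    refine (hcut _ hc').trans ?_
    rw [hf, sum_add_distrib]
    gcongr ∑ u ∈ _, ?_ + _ with u hu
    refine sum_le_sum_of_ne_zero (f := x u) fun w hw hxw => ?_
    have hadj := hadj u w hxw
    simp only [hcomp, mem_compl, Set.mem_toFinset, Set.mem_image, not_exists, not_and] at hu hw ⊢
    obtain ⟨u, huc, rfl⟩ := hu
    by_contra hwU
    refine hw ⟨w, by simpa using hwU⟩ ?_ rfl
    refine c.mem_supp_of_adj_mem_supp huc ?_
    have := u.2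
    simp_all
  have hsum : N * H.oddComponents.ncard ≤ ∑ u, f u := by
    calc N * H.oddComponents.ncard = ∑ c ∈ H.oddComponents.toFinset, N := by
          rw [sum_const, Set.ncard_eq_toFinset_card', smul_eq_mul, mul_comm]
      _ ≤ ∑ c ∈ H.oddComponents.toFinset, ∑ u ∈ comp c, f u := sum_le_sum hodd
      _ = ∑ u ∈ H.oddComponents.toFinset.biUnion comp, f u := by
          refine (sum_biUnion fun c _ c' _ hcc => ?_).symm
          simp only [Function.onFun, hcomp, Set.disjoint_toFinset]
          exact Set.disjoint_image_of_injective Subtype.val_injective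
            (SimpleGraph.pairwise_disjoint_supp_connectedComponent _ hcc)
      _ ≤ ∑ u, f u := sum_le_univ_sum_of_nonneg fun _ => Nat.zero_le _
  have hle : ∑ u, f u ≤ N * U.ncard + ∑ u, μ u := by
    rw [hf, sum_add_distrib, sum_comm, Set.ncard_eq_toFinset_card', mul_comm, ← smul_eq_mul]
    gcongr
    exact sum_le_card_nsmul _ _ _ fun w _ => hx w
  have hlt : H.oddComponents.ncard < U.ncard + 2 := by
    by_contra! h
    nlinarith [Nat.mul_le_mul_left N h]
  rw [← hverts] at hV
  rw [Nat.even_iff] at hV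
  rw [Nat.odd_iff, Nat.odd_iff] at hpar
  omega

variable {V D : Type*} [DecidableEq V] [Fintype D] {src : D → V} {σ : D → D}

theorem odd_card_filter_notMem_iff {D : Type*} [DecidableEq D] {σ : D → D}
    (hσ : σ.Involutive) (hne : ∀ d, σ d ≠ d) (A : Finset D) :
    Odd #{d ∈ A | σ d ∉ A} ↔ Odd #A := by
  have h : Even #{d ∈ A | σ d ∈ A} := by
    rw [← ZMod.natCast_eq_zero_iff_even, card_eq_sum_ones, Nat.cast_sum]
    exact sum_involution (fun d _ => σ d)
      (fun _ _ => by simpa using CharTwo.add_self_eq_zero (1 : ZMod 2)) (fun d _ _ => hne d)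
      (fun d hd => by simpa [hσ d, and_comm] using hd) (fun d _ => hσ d)
  have := card_filter_add_card_filter_not (s := A) (fun d => σ d ∈ A)
  rw [← this, Nat.odd_add', iff_comm]
  simp [h]

/-- The half-edges that leave the set of vertices `Y`, in the graph with half-edges `D`, attached
to the vertices by `src` and paired into edges by `σ`. -/
def boundary (src : D → V) (σ : D → D) (Y : Finset V) : Finset D :=
  {d | src d ∈ Y ∧ src (σ d) ∉ Y}

@[simp]
theorem mem_boundary {Y : Finset V} {d : D} :
    d ∈ boundary src σ Y ↔ src d ∈ Y ∧ src (σ d) ∉ Y := by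
  simp [boundary]

theorem odd_card_boundary_iff [DecidableEq D] (hσ : σ.Involutive) (hne : ∀ d, σ d ≠ d)
    (Y : Finset V) :
    Odd #(boundary src σ Y) ↔ Odd #{d | src d ∈ Y} := by
  rw [← odd_card_filter_notMem_iff hσ hne {d | src d ∈ Y}]
  simp only [boundary, filter_filter, mem_filter, mem_univ, true_and]

theorem odd_card_boundary_iff_of_regular [DecidableEq D] {r : ℕ} (hr : Odd r) (hσ : σ.Involutive)
    (hne : ∀ d, σ d ≠ d) (hreg : ∀ v, #{d | src d = v} = r) (Y : Finset V) :
    Odd #(boundary src σ Y) ↔ Odd #Y := by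
  rw [odd_card_boundary_iff hσ hne,
    card_eq_sum_card_fiberwise (f := src) (t := Y) (fun d hd => by simpa using hd),
    sum_congr rfl (g := fun _ => r)]
  · simp [Nat.odd_mul, hr]
  · intro v hv
    rw [← hreg v, filter_filter]
    congr 1
    ext d
    simp only [mem_filter, mem_univ, true_and, and_iff_right_iff_imp]
    rintro rfl
    exact hv

variable [DecidableEq D]

/-- Weights on the edges of the gadget which replaces every vertex by one point for each of its
half-edges and two further points, joined to all of the former. The points of two half-edges which
make up an edge are joined, with weight `m`. -/
def gadgetWeight (src : D → V) (σ : D → D) (m : ℕ) : D ⊕ V × Bool → D ⊕ V × Bool → ℕ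
  | .inl d, .inl e => if e = σ d then m else 0
  | .inl d, .inr p => if p.1 = src d then 1 else 0
  | .inr p, .inl d => if p.1 = src d then 1 else 0
  | .inr _, .inr _ => 0

theorem sum_prod_bool_ite_fst_eq {V : Type*} [Fintype V] [DecidableEq V] (v : V) :
    ∑ p : V × Bool, (if p.1 = v then 1 else 0) = 2 := by
  simp only [Fintype.sum_prod_type, Fintype.sum_bool, sum_add_distrib, sum_ite_eq', mem_univ,
    if_true]

theorem sum_gadgetWeight_le [Fintype V] {r : ℕ} (hr : 2 ≤ r) (hσ : σ.Involutive)
    (hdeg : ∀ v, #{d | src d = v} ≤ r) (b : D ⊕ V × Bool) :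
    ∑ a, gadgetWeight src σ (r - 2) a b ≤ r := by
  rw [Fintype.sum_sum_type]
  rcases b with d | p
  · have (e : D) : d = σ e ↔ σ d = e := by rw [← hσ.eq_iff]
    simp only [gadgetWeight, this, sum_ite_eq, mem_univ, if_true, sum_prod_bool_ite_fst_eq]
    omega
  · have := hdeg p.1
    rw [card_filter] at this
    simpa [gadgetWeight, eq_comm] using this

theorem le_cut_gadgetWeight [Fintype V] {r : ℕ} (hr : 4 ≤ r) (hσ : σ.Involutive)
    (hne : ∀ d, σ d ≠ d) (v₀ : V)
    (hdeg : ∀ v, #{d | src d = v} = r ∨ v = v₀ ∧ #{d | src d = v} + 1 = r)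
    (hbd : ∀ Y, #(boundary src σ Y) ≠ 1) (W : Finset (D ⊕ V × Bool)) (hW : Odd #W) :
    r ≤ ∑ a ∈ W, ∑ b ∈ Wᶜ, gadgetWeight src σ (r - 2) a b +
      ∑ a ∈ W, Sum.elim 0 (fun p => if p.1 = v₀ then 1 else 0) a := by
  set x := gadgetWeight src σ (r - 2) with hx
  rw [← sum_product']
  have hsub (P : Finset _) (hP : P ⊆ W ×ˢ Wᶜ) :
      ∑ p ∈ P, x p.1 p.2 ≤ ∑ p ∈ W ×ˢ Wᶜ, x p.1 p.2 := sum_le_sum_of_subset hP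
  by_cases h : ∃ v i, .inr (v, i) ∈ W ∧ .inr (v, !i) ∉ W
  · obtain ⟨v, i, hi, hi'⟩ := h
    have hle : #{d | src d = v} ≤ ∑ p ∈ W ×ˢ Wᶜ, x p.1 p.2 := by
      let g (d : D) : (D ⊕ V × Bool) × (D ⊕ V × Bool) :=
        if .inl d ∈ W then (.inl d, .inr (v, !i)) else (.inr (v, i), .inl d)
      have hg : g.Injective := by
        intro d e hde
        simp only [g] at hde
        split_ifs at hde <;> simp_all
      refine le_trans ?_ (hsub (({d | src d = v} : Finset D).image g) ?_)
      · rw [sum_image hg.injOn, card_eq_sum_ones]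
        refine sum_le_sum fun d hd => ?_
        have hd : v = src d := by simpa [eq_comm] using hd
        simp only [g]
        split_ifs <;> simp [hx, gadgetWeight, hd]
      · intro p hp
        obtain ⟨d, -, rfl⟩ := mem_image.1 hp
        simp only [g]
        split_ifs with hd <;> simp [hd, hi, hi']
    obtain h | ⟨rfl, h⟩ := hdeg v
    · omega
    · have : 1 ≤ ∑ a ∈ W, Sum.elim 0 (fun p => if p.1 = v then 1 else 0) a :=
        le_trans (by simp) (single_le_sum (fun _ _ => Nat.zero_le _) hi)
      omega
  · have h (v : V) (i j : Bool) : .inr (v, i) ∈ W ↔ .inr (v, j) ∈ W := by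
      have := not_exists.1 h v
      push Not at this
      have h1 := this true
      have h2 := this false
      cases i <;> cases j <;> simp only [Bool.not_true, Bool.not_false] at h1 h2 ⊢ <;> tauto
    refine le_trans ?_ (Nat.le_add_right _ _)
    have hcard : #W.toLeft + 2 * #({v | .inr (v, true) ∈ W} : Finset V) = #W := by
      rw [← card_toLeft_add_card_toRight (u := W)]
      congr 1
      have : W.toRight = ({v | .inr (v, true) ∈ W} : Finset V) ×ˢ univ := by
        ext ⟨v, i⟩
        simpa using h v i true
      rw [this, card_product, mul_comm]
      rfl
    have hodd : Odd #{d ∈ W.toLeft | σ d ∉ W.toLeft} := by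
      rw [odd_card_filter_notMem_iff hσ hne]
      rw [Nat.odd_iff] at hW ⊢
      omega
    by_cases hdev : ∃ e, ¬ (.inl e ∈ W ↔ .inr (src e, true) ∈ W)
    · obtain ⟨e, he⟩ := hdev
      obtain ⟨d, hd⟩ := card_pos.1 hodd.pos
      simp only [mem_filter, mem_toLeft] at hd
      by_cases heW : .inl e ∈ W
      · have he' (i) : .inr (src e, i) ∉ W := by rw [h _ i true]; tauto
        refine le_trans ?_ (hsub {(.inl d, .inl (σ d)), (.inl e, .inr (src e, true)),
          (.inl e, .inr (src e, false))} ?_)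
        · simp [hx, gadgetWeight]
          omega
        · simp [insert_subset_iff, *]
      · have he' (i) : .inr (src e, i) ∈ W := by rw [h _ i true]; tauto
        refine le_trans ?_ (hsub {(.inl d, .inl (σ d)), (.inr (src e, true), .inl e),
          (.inr (src e, false), .inl e)} ?_)
        · simp [hx, gadgetWeight]
          omega
        · simp [insert_subset_iff, *]
    · push Not at hdev
      have hB : ({d ∈ W.toLeft | σ d ∉ W.toLeft} : Finset D) =
          boundary src σ {v | .inr (v, true) ∈ W} := by
        ext d
        simp [hdev]
      refine le_trans ?_ (hsub (({d ∈ W.toLeft | σ d ∉ W.toLeft} : Finset D).image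
        fun d => (.inl d, .inl (σ d))) ?_)
      · rw [sum_image fun _ _ _ _ hde => by simpa using congrArg Prod.fst hde]
        simp only [hx, gadgetWeight, if_true, sum_const, smul_eq_mul]
        have h1 := hbd {v | .inr (v, true) ∈ W}
        rw [← hB] at h1
        have h2 : 2 ≤ #{d ∈ W.toLeft | σ d ∉ W.toLeft} := by
          have := hodd.pos
          omega
        calc r ≤ 2 * (r - 2) := by omega
          _ ≤ _ := Nat.mul_le_mul_right _ h2
      · intro p hp
        obtain ⟨d, hd, rfl⟩ := mem_image.1 hp
        simpa using hd

/-- A graph of degree `r ≥ 4`, up to one missing half-edge at one vertex, in which no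
set of vertices is left by exactly one edge, has a `2`-factor; `F` is its complement. -/
theorem exists_compl_two_factor [Fintype V] {r : ℕ} (hr : 4 ≤ r) (hσ : σ.Involutive)
    (hne : ∀ d, σ d ≠ d) (v₀ : V)
    (hdeg : ∀ v, #{d | src d = v} = r ∨ v = v₀ ∧ #{d | src d = v} + 1 = r)
    (hbd : ∀ Y, #(boundary src σ Y) ≠ 1) :
    ∃ F : Finset D, (∀ d ∈ F, σ d ∈ F) ∧
      ∀ v, #{d ∈ F | src d = v} + 2 = #{d | src d = v} := by
  classical
  set x := gadgetWeight src σ (r - 2) with hx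
  have hσ' (d e : D) : d = σ e ↔ e = σ d := by rw [eq_comm (a := e), hσ.eq_iff]
  let G : SimpleGraph (D ⊕ V × Bool) :=
    { Adj := fun a b => x a b ≠ 0
      symm := by
        refine ⟨?_⟩
        rintro (d | p) (e | q) <;> simp [hx, gadgetWeight]
        intro h1 h2
        exact ⟨(hσ' d e).2 h1, h2⟩
      loopless := ⟨by rintro (d | p) <;> simp [hx, gadgetWeight, (hne _).symm]⟩ }
  have hcard : Even (Fintype.card (D ⊕ V × Bool)) := by
    have h := odd_card_filter_notMem_iff hσ hne univ
    simp only [mem_univ, not_true, filter_false, card_empty, Nat.not_odd_zero, false_iff,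
      Nat.not_odd_iff_even, card_univ] at h
    simp [h, Nat.even_add]
  obtain ⟨M, hM, hM'⟩ := exists_isPerfectMatching_of_weight G hcard x
    (Sum.elim 0 (fun p => if p.1 = v₀ then 1 else 0)) r (fun _ _ h => h)
    (sum_gadgetWeight_le (by omega) hσ fun v => by have := hdeg v; omega)
    (by
      simp only [Fintype.sum_sum_type, Sum.elim_inl, Sum.elim_inr, Pi.zero_apply, sum_const_zero,
        sum_prod_bool_ite_fst_eq]
      omega)
    (le_cut_gadgetWeight hr hσ hne v₀ hdeg hbd)
  replace hM (a) : ∃! b, M.Adj a b := hM (hM' a)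
  have hinr (p : V × Bool) : ∃ d, M.Adj (.inr p) (.inl d) ∧ src d = p.1 := by
    obtain ⟨b, hb, -⟩ := hM (.inr p)
    have hG := M.adj_sub hb
    rcases b with d | q
    · exact ⟨d, hb, by simpa [G, hx, gadgetWeight, eq_comm] using hG⟩
    · simp [G, hx, gadgetWeight] at hG
  choose f hf hfsrc using hinr
  refine ⟨univ.filter fun d => M.Adj (.inl d) (.inl (σ d)), fun d hd => ?_, fun v => ?_⟩
  · simpa [hσ d, M.adj_comm] using hd
  · have hfv (d : D) : src d = v ∧ ¬ M.Adj (.inl d) (.inl (σ d)) ↔ ∃ i, f (v, i) = d := by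
      constructor
      · rintro ⟨rfl, hd⟩
        obtain ⟨b, hb, -⟩ := hM (.inl d)
        have hG := M.adj_sub hb
        rcases b with e | ⟨w, i⟩
        · obtain ⟨rfl, -⟩ : e = σ d ∧ _ := by simpa [G, hx, gadgetWeight] using hG
          exact absurd hb hd
        · obtain rfl : w = src d := by simpa [G, hx, gadgetWeight] using hG
          exact ⟨i, Sum.inl_injective ((hM _).unique (hf _) hb.symm)⟩
      · rintro ⟨i, rfl⟩
        refine ⟨hfsrc _, fun h => ?_⟩
        simpa using (hM _).unique h (hf _).symm
    have h2 : #{d | src d = v ∧ ¬ M.Adj (.inl d) (.inl (σ d))} = 2 := by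
      have : ({d | src d = v ∧ ¬ M.Adj (.inl d) (.inl (σ d))} : Finset D) =
          univ.image fun i => f (v, i) := by
        ext d
        simpa only [mem_filter, mem_univ, true_and, mem_image] using hfv d
      rw [this, card_image_of_injective, card_univ, Fintype.card_bool]
      intro i j hij
      have := (hM _).unique (hf (v, i)).symm (by simpa [hij] using (hf (v, j)).symm)
      simpa using this
    rw [← h2, ← card_filter_add_card_filter_not (s := {d | src d = v})
      (fun d => M.Adj (.inl d) (.inl (σ d))), filter_filter, filter_filter, filter_filter]
    simp only [and_comm]

theorem card_filter_map_subtype {D : Type*} {p : D → Prop} (F : Finset {d // p d}) (q : D → Prop)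
    [DecidablePred q] :
    #{d ∈ F.map (Function.Embedding.subtype p) | q d} = #{d ∈ F | q d.1} := by
  rw [filter_map, card_map]
  rfl

/-- If `X` is minimal among the sets of vertices left by exactly one edge, then the graph spanned
by `X`, together with that edge, has a factor in which all degrees are `r - 2`. -/
theorem exists_factor_of_minimal {r : ℕ} (hr : 4 ≤ r) (hσ : σ.Involutive) (hne : ∀ d, σ d ≠ d)
    (hreg : ∀ v, #{d | src d = v} = r) {X : Finset V} {a : D} (hX : boundary src σ X = {a})
    (hmin : ∀ Y ⊂ X, #(boundary src σ Y) ≠ 1) :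
    ∃ F : Finset D, (∀ d ∈ F, src d ∈ X) ∧ (∀ d ∈ F, src (σ d) ∈ X → σ d ∈ F) ∧ a ∈ F ∧
      ∀ v ∈ X, #{d ∈ F | src d = v} + 2 = r := by
  have ha (d : D) : src d ∈ X ∧ src (σ d) ∉ X ↔ d = a := by
    rw [← mem_boundary, hX, mem_singleton]
  have haX := (ha a).2 rfl
  let src' (d : {d // src d ∈ X ∧ src (σ d) ∈ X}) : X := ⟨src d, d.2.1⟩
  let σ' (d : {d // src d ∈ X ∧ src (σ d) ∈ X}) : {d // src d ∈ X ∧ src (σ d) ∈ X} :=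
    ⟨σ d, d.2.2, by rw [hσ]; exact d.2.1⟩
  let ι := Function.Embedding.subtype fun d => src d ∈ X ∧ src (σ d) ∈ X
  have hcard (F : Finset {d // src d ∈ X ∧ src (σ d) ∈ X}) (v : X) :
      #{d ∈ insert a (F.map ι) | src d = v} =
        #{d ∈ F | src' d = v} + if src a = v then 1 else 0 := by
    have haF : a ∉ F.map ι := by
      simp only [mem_map, not_exists, not_and]
      rintro d - rfl
      exact haX.2 d.2.2
    have := card_filter_map_subtype F (fun d => src d = v)
    simp only [src', Subtype.ext_iff, filter_insert, ← this]
    split_ifs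
    · rw [card_insert_of_notMem fun h => haF (mem_filter.1 h).1]
    · rfl
  have hdeg (v : X) : #{d | src' d = v} + (if src a = v then 1 else 0) = r := by
    rw [← hcard, ← hreg v]
    congr 1
    ext d
    have := ha d
    simp only [mem_filter, mem_insert, mem_map, mem_univ, true_and, and_iff_right_iff_imp]
    intro hd
    have hdX : src d ∈ X := hd ▸ v.2
    by_cases h : src (σ d) ∈ X
    · exact .inr ⟨⟨d, hdX, h⟩, rfl⟩
    · exact .inl ((ha d).1 ⟨hdX, h⟩)
  obtain ⟨F, hF, hFdeg⟩ := exists_compl_two_factor (src := src') (σ := σ') hr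
    (fun d => Subtype.ext (hσ _)) (fun d h => hne d (congrArg Subtype.val h)) ⟨src a, haX.1⟩
    (fun v => by
      have := hdeg v
      split_ifs at this with h
      · exact .inr ⟨Subtype.ext h.symm, this⟩
      · exact .inl this)
    (fun Y hY => by
      obtain ⟨e, he⟩ := card_eq_one.1 hY
      have he' (d) : d ∈ boundary src' σ' Y ↔ d = e := by rw [he, mem_singleton]
      simp only [mem_boundary] at he'
      have heY := (he' e).2 rfl
      set Z : Finset V := Y.map (Function.Embedding.subtype _) with hZ
      have hZX : Z ⊆ X := by
        intro v hv
        obtain ⟨w, -, rfl⟩ := mem_map.1 hv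
        exact w.2
      have hYZ (w : X) : w ∈ Y ↔ (w : V) ∈ Z := by simp [hZ]
      simp only [hYZ, src', σ'] at he' heY
      by_cases haZ : src a ∈ Z
      · refine hmin (X \ Z) ?_ (card_eq_one.2 ⟨σ e, ?_⟩)
        · refine ⟨sdiff_subset, fun h => ?_⟩
          exact (mem_sdiff.1 (h (hZX haZ))).2 haZ
        · ext d
          simp only [mem_boundary, mem_sdiff, mem_singleton]
          constructor
          · rintro ⟨⟨hdX, hdZ⟩, h⟩
            have hd : src (σ d) ∈ X := by
              by_contra hd
              exact hdZ ((ha d).1 ⟨hdX, hd⟩ ▸ haZ)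
            have := (he' ⟨σ d, hd, by rwa [hσ]⟩).1 ⟨by tauto, by rwa [hσ]⟩
            rw [← this, hσ]
          · rintro rfl
            rw [hσ]
            exact ⟨⟨e.2.2, heY.2⟩, fun h => h.2 heY.1⟩
      · refine hmin Z ⟨hZX, fun h => haZ (h haX.1)⟩ (card_eq_one.2 ⟨e, ?_⟩)
        ext d
        simp only [mem_boundary, mem_singleton]
        constructor
        · rintro ⟨hd, hd'⟩
          have hdX : src (σ d) ∈ X := by
            by_contra hdX
            exact haZ ((ha d).1 ⟨hZX hd, hdX⟩ ▸ hd)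
          exact congrArg Subtype.val ((he' ⟨d, hZX hd, hdX⟩).1 ⟨hd, hd'⟩)
        · rintro rfl
          exact heY)
  refine ⟨insert a (F.map ι), fun d hd => ?_, fun d hd hdX => ?_, mem_insert_self _ _,
    fun v hv => ?_⟩
  · obtain rfl | hd := mem_insert.1 hd
    · exact haX.1
    · obtain ⟨d, -, rfl⟩ := mem_map.1 hd
      exact d.2.1
  · obtain rfl | hd := mem_insert.1 hd
    · exact absurd hdX haX.2
    · obtain ⟨d, hdF, rfl⟩ := mem_map.1 hd
      exact mem_insert_of_mem (mem_map_of_mem ι (hF d hdF))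
  · rw [← hdeg ⟨v, hv⟩, ← hFdeg ⟨v, hv⟩, hcard F ⟨v, hv⟩]
    omega

/-- If no subset of `U` is left by exactly one edge, then `U`, with the half-edges leaving `U` kept
loose, has a factor in which all degrees are `r - 2`. The proof joins two copies of `U` along their
loose half-edges. -/
theorem exists_factor_of_no_bridge [Fintype V] {r : ℕ} (hr : 4 ≤ r) (hodd : Odd r)
    (hσ : σ.Involutive) (hne : ∀ d, σ d ≠ d) (hreg : ∀ v, #{d | src d = v} = r)
    {U : Finset V} (hU : U.Nonempty)
    (hbd : ∀ Y ⊆ U, #(boundary src σ Y) ≠ 1) :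
    ∃ F : Finset D, (∀ d ∈ F, src d ∈ U) ∧ (∀ d ∈ F, src (σ d) ∈ U → σ d ∈ F) ∧
      ∀ v ∈ U, #{d ∈ F | src d = v} + 2 = r := by
  classical
  let src' (d : {d // src d ∈ U} × Bool) : U × Bool := (⟨src d.1, d.1.2⟩, d.2)
  let σ' (d : {d // src d ∈ U} × Bool) : {d // src d ∈ U} × Bool :=
    if h : src (σ d.1) ∈ U then (⟨σ d.1, h⟩, d.2) else (d.1, !d.2)
  have hσ' : σ'.Involutive := by
    rintro ⟨⟨d, hd⟩, c⟩
    by_cases h : src (σ d) ∈ U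
    · simp [σ', h, hσ d, hd]
    · simp [σ', h]
  have hne' (d) : σ' d ≠ d := by
    obtain ⟨⟨d, hd⟩, c⟩ := d
    by_cases h : src (σ d) ∈ U <;> simp [σ', h, hne]
  have hcard (F : Finset ({d // src d ∈ U} × Bool)) (v : U) (c : Bool) :
      #{d | (∃ h, (⟨d, h⟩, c) ∈ F) ∧ src d = v} = #{d ∈ F | src' d = (v, c)} := by
    symm
    refine card_bij (fun d _ => d.1.1) ?_ ?_ ?_
    · rintro ⟨⟨d, hd⟩, c'⟩ h
      simp only [src', mem_filter, Prod.mk.injEq, Subtype.ext_iff] at h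
      obtain ⟨h, h', rfl⟩ := h
      simpa using ⟨⟨hd, h⟩, h'⟩
    · rintro ⟨⟨d, hd⟩, c'⟩ h ⟨⟨e, he⟩, c''⟩ h' hde
      simp only [src', mem_filter, Prod.mk.injEq, Subtype.ext_iff] at h h' ⊢
      exact ⟨hde, h.2.2.trans h'.2.2.symm⟩
    · intro d hd
      obtain ⟨⟨h, hF⟩, hv⟩ := (mem_filter.1 hd).2
      exact ⟨(⟨d, h⟩, c), by simpa [src', hF, Subtype.ext_iff] using hv, rfl⟩
  have hreg' (v : U × Bool) : #{d | src' d = v} = r := by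
    rw [← hreg v.1, ← hcard univ v.1 v.2]
    congr 1
    ext d
    simp only [mem_univ, exists_prop, and_true, mem_filter, true_and, and_iff_right_iff_imp]
    exact fun h => h ▸ v.1.2
  obtain ⟨u, hu⟩ := hU
  obtain ⟨F, hF, hFdeg⟩ := exists_compl_two_factor hr hσ' hne' (⟨u, hu⟩, true)
    (fun v => .inl (hreg' v))
    (fun Y hY => by
      let Z (c : Bool) : Finset V := {v | ∃ h : v ∈ U, (⟨v, h⟩, c) ∈ Y}
      have hZ (v : V) (hv : v ∈ U) (c : Bool) : (⟨v, hv⟩, c) ∈ Y ↔ v ∈ Z c := by simp [Z, hv]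
      have hZU (c : Bool) : Z c ⊆ U := fun v hv => (mem_filter.1 hv).2.1
      obtain ⟨e, he⟩ := card_eq_one.1 hY
      have he' (d) (hd : d ∈ boundary src' σ' Y) : d = e := by rwa [he, mem_singleton] at hd
      have hT (v : V) : v ∈ symmDiff (Z true) (Z false) ↔ ∃ c, v ∈ Z c ∧ v ∉ Z !c := by
        simp [mem_symmDiff, or_comm]
      have hTU : symmDiff (Z true) (Z false) ⊆ U := by
        intro v hv
        obtain ⟨c, hc, -⟩ := (hT v).1 hv
        exact hZU c hc
      have hTcard : Odd #(symmDiff (Z true) (Z false)) := by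
        have hYodd := (odd_card_boundary_iff_of_regular hodd hσ' hne' hreg' Y).1 (by simp [hY])
        have hYcard : #Y = #(Z true) + #(Z false) := by
          have hYc (c : Bool) : #{p ∈ Y | p.2 = c} = #(Z c) := by
            refine card_bij (fun p _ => p.1.1) ?_ ?_ ?_
            · rintro ⟨⟨v, hv⟩, c'⟩ h
              obtain ⟨hp, rfl⟩ := mem_filter.1 h
              exact (hZ v hv _).1 hp
            · rintro ⟨v, c'⟩ h ⟨w, c''⟩ h' hvw
              exact Prod.ext (Subtype.ext hvw) ((mem_filter.1 h).2.trans (mem_filter.1 h').2.symm)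
            · intro v hv
              exact ⟨(⟨v, hZU c hv⟩, c), by simpa [hZ] using hv, rfl⟩
          rw [← hYc, ← hYc, ← card_filter_add_card_filter_not (s := Y) (fun p => p.2 = true)]
          simp
        have h1 : #(symmDiff (Z true) (Z false)) =
            #(Z true \ Z false) + #(Z false \ Z true) :=
          card_union_of_disjoint disjoint_sdiff_sdiff
        have h2 := card_sdiff_add_card_inter (Z true) (Z false)
        have h3 := card_sdiff_add_card_inter (Z false) (Z true)
        rw [inter_comm] at h3
        rw [Nat.odd_iff] at hYodd ⊢
        omega
      have hedge (d) (hd : d ∈ boundary src σ (symmDiff (Z true) (Z false))) :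
          e.1.1 = d ∨ e.1.1 = σ d := by
        obtain ⟨hd, hd'⟩ := mem_boundary.1 hd
        have hdU := hTU hd
        obtain ⟨c, hc, hc'⟩ := (hT _).1 hd
        by_cases h : src (σ d) ∈ U
        · by_cases hσd : src (σ d) ∈ Z c
          · right
            rw [← he' (⟨σ d, h⟩, !c)]
            have hσd' : src (σ d) ∈ Z !c := by
              by_contra hσd'
              exact hd' ((hT _).2 ⟨c, hσd, hσd'⟩)
            simp [src', σ', hZ, hσ d, hdU, hc', hσd']
          · left
            rw [← he' (⟨d, hdU⟩, c)]
            simp [src', σ', hZ, h, hc, hσd]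
        · left
          rw [← he' (⟨d, hdU⟩, c)]
          simp [src', σ', hZ, h, hc, hc']
      refine hbd _ hTU (le_antisymm (card_le_one.2 fun d hd d' hd' => ?_)
        ((odd_card_boundary_iff_of_regular hodd hσ hne hreg _).2 hTcard).pos)
      have hb := mem_boundary.1 hd
      have hb' := mem_boundary.1 hd'
      obtain h | h := hedge d hd <;> obtain h' | h' := hedge d' hd'
      · exact h.symm.trans h'
      · exact absurd (h.symm.trans h' ▸ hb.1) hb'.2
      · exact absurd (h'.symm.trans h ▸ hb'.1) hb.2
      · exact hσ.injective (h.symm.trans h'))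
  refine ⟨univ.filter fun d => ∃ h, (⟨d, h⟩, true) ∈ F, fun d hd => ?_, fun d hd hdU => ?_,
    fun v hv => ?_⟩
  · exact (mem_filter.1 hd).2.1
  · obtain ⟨h, hd⟩ := (mem_filter.1 hd).2
    simpa [σ', hdU] using hF _ hd
  · rw [← hreg' (⟨v, hv⟩, true), ← hFdeg, ← hcard, filter_filter]

/-- Some set of vertices of `U`, with some of the half-edges attached to them, spans an
`(r - 2)`-regular structure, in which only half-edges leaving `U` may lack their partner. -/
theorem exists_partial_factor [Fintype V] {r : ℕ} (hr : 4 ≤ r) (hodd : Odd r) (hσ : σ.Involutive)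
    (hne : ∀ d, σ d ≠ d) (hreg : ∀ v, #{d | src d = v} = r) (U : Finset V) (hU : U.Nonempty) :
    ∃ F : Finset D, (∀ d ∈ F, src d ∈ U) ∧ (∀ d ∈ F, src (σ d) ∈ U → σ d ∈ F) ∧
      (∀ v, #{d ∈ F | src d = v} = 0 ∨ #{d ∈ F | src d = v} + 2 = r) ∧
      ∃ v, #{d ∈ F | src d = v} + 2 = r := by
  classical
  induction U using Finset.strongInduction with
  | H U ih =>
  have hzero {F : Finset D} {X : Finset V} (hF : ∀ d ∈ F, src d ∈ X) {v : V} (hv : v ∉ X) :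
      ({d ∈ F | src d = v} : Finset D) = ∅ :=
    filter_eq_empty_iff.2 fun d hd hdv => hv (hdv ▸ hF d hd)
  by_cases h : ∃ X ⊆ U, #(boundary src σ X) = 1
  · obtain ⟨X, hX⟩ := exists_minimal (s := {X ∈ U.powerset | #(boundary src σ X) = 1}) (by
      obtain ⟨X, hX⟩ := h
      exact ⟨X, by simpa using hX⟩)
    obtain ⟨hXU, hXbd⟩ : X ⊆ U ∧ #(boundary src σ X) = 1 := by simpa using hX.prop
    obtain ⟨a, ha⟩ := card_eq_one.1 hXbd
    have ha' (d : D) : src d ∈ X ∧ src (σ d) ∉ X ↔ d = a := by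
      rw [← mem_boundary, ha, mem_singleton]
    have haX := (ha' a).2 rfl
    obtain ⟨F, hFX, hF, haF, hFdeg⟩ := exists_factor_of_minimal hr hσ hne hreg ha fun Y hY hYbd =>
      hX.not_prop_of_lt hY (by simpa using ⟨hY.subset.trans hXU, hYbd⟩)
    by_cases haU : src (σ a) ∈ U
    · obtain ⟨F', hFX', hF', hFdeg', v, hv⟩ := ih (U \ X)
        (sdiff_ssubset hXU ⟨_, haX.1⟩) ⟨_, mem_sdiff.2 ⟨haU, haX.2⟩⟩
      simp only [mem_sdiff] at hFX' hF'
      by_cases haF' : σ a ∈ F'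
      · refine ⟨F ∪ F', fun d hd => ?_, fun d hd hdU => ?_, fun v => ?_, src a, ?_⟩
        · obtain hd | hd := mem_union.1 hd
          · exact hXU (hFX d hd)
          · exact (hFX' d hd).1
        · rw [mem_union]
          by_cases hdX : src (σ d) ∈ X
          · obtain hd | hd := mem_union.1 hd
            · exact .inl (hF d hd hdX)
            · rw [(ha' (σ d)).1 ⟨hdX, by rw [hσ]; exact (hFX' d hd).2⟩]
              exact .inl haF
          · obtain hd | hd := mem_union.1 hd
            · rw [(ha' d).1 ⟨hFX d hd, hdX⟩]
              exact .inr haF'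
            · exact .inr (hF' d hd ⟨hdU, hdX⟩)
        · by_cases hvX : v ∈ X
          · right
            rw [filter_union, hzero (fun d hd => mem_sdiff.2 (hFX' d hd))
              (fun h => (mem_sdiff.1 h).2 hvX), union_empty, hFdeg v hvX]
          · rw [filter_union, hzero hFX hvX, empty_union]
            exact hFdeg' v
        · rw [filter_union, hzero (fun d hd => mem_sdiff.2 (hFX' d hd))
            (fun h => (mem_sdiff.1 h).2 haX.1), union_empty, hFdeg _ haX.1]
      · refine ⟨F', fun d hd => (hFX' d hd).1, fun d hd hdU => hF' d hd ⟨hdU, fun hdX => haF' ?_⟩,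
          hFdeg', v, hv⟩
        rwa [← (ha' (σ d)).1 ⟨hdX, by rw [hσ]; exact (hFX' d hd).2⟩, hσ]
    · refine ⟨F, fun d hd => hXU (hFX d hd), fun d hd hdU => hF d hd ?_, fun v => ?_, src a,
        hFdeg _ haX.1⟩
      · by_contra hdX
        exact haU ((ha' d).1 ⟨hFX d hd, hdX⟩ ▸ hdU)
      · by_cases hvX : v ∈ X
        · exact .inr (hFdeg v hvX)
        · simp [hzero hFX hvX]
  · push Not at h
    obtain ⟨F, hFU, hF, hFdeg⟩ := exists_factor_of_no_bridge hr hodd hσ hne hreg hU h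
    obtain ⟨u, hu⟩ := hU
    refine ⟨F, hFU, hF, fun v => ?_, u, hFdeg u hu⟩
    by_cases hv : v ∈ U
    · exact .inr (hFdeg v hv)
    · simp [hzero hFU hv]

/-- A `(k + 2 * j)`-regular graph, with `k ≥ 3` odd, has a non-empty `k`-regular subgraph, given by
its set of half-edges `F`. -/
theorem exists_regular_of_odd {k : ℕ} (hk : Odd k) (hk3 : 3 ≤ k) (j : ℕ) {V D : Type*} [Fintype V]
    [DecidableEq V] [Nonempty V] [Fintype D] [DecidableEq D] {src : D → V} {σ : D → D}
    (hσ : σ.Involutive) (hne : ∀ d, σ d ≠ d) (hreg : ∀ v, #{d | src d = v} = k + 2 * j) :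
    ∃ F : Finset D, (∀ d ∈ F, σ d ∈ F) ∧
      (∀ v, #{d ∈ F | src d = v} = 0 ∨ #{d ∈ F | src d = v} = k) ∧
      ∃ v, #{d ∈ F | src d = v} = k := by
  induction j generalizing V D with
  | zero => exact ⟨univ, by simp, fun v => .inr (hreg v), Classical.arbitrary V, hreg _⟩
  | succ j ih =>
    obtain ⟨F, -, hF, hFdeg, u, hu⟩ := exists_partial_factor (by omega)
      (by rw [Nat.odd_iff] at hk ⊢; omega) hσ hne hreg univ univ_nonempty
    simp only [mem_univ, true_imp_iff] at hF
    let src' (d : F) : {v // #{d ∈ F | src d = v} ≠ 0} :=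
      ⟨src d, card_ne_zero.2 ⟨d, by simp⟩⟩
    let ι := Function.Embedding.subtype (· ∈ F)
    have : Nonempty {v // #{d ∈ F | src d = v} ≠ 0} := ⟨u, by omega⟩
    obtain ⟨F', hF', hFdeg', w, hw⟩ := ih (src := src') (σ := fun d => ⟨σ d, hF d d.2⟩)
      (fun d => Subtype.ext (hσ _)) (fun d h => hne d (congrArg Subtype.val h)) (fun v => by
        have h1 := (hFdeg v).resolve_left v.2
        have h2 := card_filter_map_subtype (univ : Finset F) (fun d => src d = v)
        have h3 : (univ : Finset F).map ι = F := by ext; simp [ι]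
        rw [h3] at h2
        simp only [src', Subtype.ext_iff]
        omega)
    have hcard (v) : #{d ∈ F'.map ι | src d = v.1} = #{d ∈ F' | src' d = v} := by
      simp only [src', Subtype.ext_iff]
      exact card_filter_map_subtype F' _
    refine ⟨F'.map ι, fun d hd => ?_, fun v => ?_, w, (hcard w).trans hw⟩
    · obtain ⟨d, hdF, rfl⟩ := mem_map.1 hd
      exact mem_map_of_mem ι (hF' d hdF)
    · by_cases hv : #{d ∈ F | src d = v} = 0
      · left
        rw [card_eq_zero, filter_eq_empty_iff] at hv ⊢
        intro d hd
        obtain ⟨d, -, rfl⟩ := mem_map.1 hd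
        exact hv d.2
      · rw [hcard ⟨v, hv⟩]
        exact hFdeg' _

end RegularSubgraph

theorem statement17 (r k : ℕ) (hr : Odd r) (hk : Odd k) (hk0 : 0 < k) (hkr : k < r)
    (V : Type) [Fintype V] [Nonempty V] (G : SimpleGraph V)
    (hreg : ∀ v : V, {u : V | G.Adj v u}.ncard = r) :
    ∃ H : G.Subgraph, H.verts.Nonempty ∧
      ∀ v ∈ H.verts, {u : V | H.Adj v u}.ncard = k := by
  classical
  obtain rfl | hk3 : k = 1 ∨ 3 ≤ k := by rw [Nat.odd_iff] at hk; omega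
  · let v := Classical.arbitrary V
    obtain ⟨w, hw⟩ := Set.nonempty_of_ncard_ne_zero (s := {u | G.Adj v u}) (by rw [hreg]; omega)
    refine ⟨G.subgraphOfAdj hw, ⟨v, by simp⟩, fun u hu => ?_⟩
    obtain ⟨x, hx, hux⟩ := SimpleGraph.Subgraph.IsMatching.subgraphOfAdj hw hu
    exact Set.ncard_eq_one.2 ⟨x, Set.eq_singleton_iff_unique_mem.2 ⟨hx, hux⟩⟩
  · obtain ⟨j, rfl⟩ : ∃ j, r = k + 2 * j := ⟨(r - k) / 2, by rw [Nat.odd_iff] at hk hr; omega⟩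
    have hdeg (v : V) :
        (Finset.univ.filter fun d : G.Dart => d.fst = v).card = k + 2 * j := by
      have hv : G.degree v = k + 2 * j := by
        rw [← hreg v, Set.ncard_eq_toFinset_card', ← SimpleGraph.card_neighborFinset_eq_degree]
        congr 1
      rw [← hv, ← G.dart_fst_fiber_card_eq_degree v]
    obtain ⟨F, hF, hFdeg, u, hu⟩ := exists_regular_of_odd hk hk3 j
      (src := fun d : G.Dart => d.fst) SimpleGraph.Dart.symm_involutive
      SimpleGraph.Dart.symm_ne hdeg
    let H : G.Subgraph :=
      { verts := {v | (F.filter fun d => d.fst = v).card = k}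
        Adj := fun v w => ∃ h : G.Adj v w, ⟨(v, w), h⟩ ∈ F
        adj_sub := fun h => h.1
        edge_vert := fun {v w} ⟨h, hF⟩ => (hFdeg v).resolve_left
          (Finset.card_ne_zero.2 ⟨_, Finset.mem_filter.2 ⟨hF, rfl⟩⟩)
        symm := ⟨fun v w ⟨h, hvw⟩ => ⟨h.symm, hF _ hvw⟩⟩ }
    refine ⟨H, ⟨u, hu⟩, fun v hv => ?_⟩
    have hset : {w | H.Adj v w} = (F.filter fun d => d.fst = v).image fun d => d.snd := by
      ext w
      simp only [Finset.coe_image, Finset.coe_filter, Set.mem_image]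
      constructor
      · rintro ⟨h, hvw⟩
        exact ⟨_, ⟨hvw, rfl⟩, rfl⟩
      · rintro ⟨d, ⟨hd, rfl⟩, rfl⟩
        exact ⟨d.adj, hd⟩
    rw [hset, Set.ncard_coe_finset, Finset.card_image_of_injOn]
    · exact hv
    · intro d hd e he hde
      simp only [Finset.coe_filter, Set.mem_ofPred_eq] at hd he
      exact SimpleGraph.Dart.ext _ _ (Prod.ext (hd.2.trans he.2.symm) hde)
end

section
/- Let r be a positive odd integer and k a positive even integer with 2 ≤ k ≤ 2r/3. Then every finite simple r-regular graph contains a k-regular subgraph with non-empty vertex set, provided the graph itself has non-empty vertex set. -/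
namespace SimpleGraph

/-- A weighted sufficient condition for a perfect matching: the weights give every vertex total at
most `r`, and every odd vertex set has a boundary of weight at least `r`, up to a bounded defect. -/
theorem exists_isPerfectMatching_of_weight {W : Type*} [Fintype W] [DecidableEq W]
    (H : SimpleGraph W) (wt : W → W → ℕ) (r k : ℕ) (D : Finset W)
    (hcard : Even (Fintype.card W)) (hadj : ∀ x y, wt x y ≠ 0 → H.Adj x y)
    (hrow : ∀ y, ∑ x, wt x y ≤ r) (hD : k * D.card < 2 * r)
    (hodd : ∀ C : Finset W, Odd C.card →
      r ≤ ∑ x ∈ C, ∑ y ∈ Cᶜ, wt x y + k * (C ∩ D).card) :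
    ∃ M : H.Subgraph, M.IsPerfectMatching := by
  classical
  rw [tutte]
  intro u hu
  unfold IsTutteViolator at hu
  set K := ((⊤ : H.Subgraph).deleteVerts u).coe with hK
  have hverts : ∀ x, x ∈ ((⊤ : H.Subgraph).deleteVerts u).verts ↔ x ∉ u := by simp
  have hpar : Even (K.oddComponents.ncard + u.ncard) := by
    have h1 := odd_ncard_oddComponents (G := K)
    have h2 : Nat.card ((⊤ : H.Subgraph).deleteVerts u).verts + u.ncard = Fintype.card W := by
      have h3 : ((⊤ : H.Subgraph).deleteVerts u).verts = uᶜ := by ext x; simp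
      rw [h3, Nat.card_coe_set_eq, add_comm, Set.ncard_add_ncard_compl, Nat.card_eq_fintype_card]
    rw [← h2] at hcard
    grind
  let S : K.ConnectedComponent → Finset W := fun c ↦
    c.supp.toFinset.map (Function.Embedding.subtype _)
  have hS : ∀ c x, x ∈ S c ↔ ∃ h, K.connectedComponentMk ⟨x, h⟩ = c := by
    intro c x
    simp [S]
  have hScard : ∀ c, (S c).card = c.supp.ncard := by
    intro c
    simp [S, Set.ncard_eq_toFinset_card']
  set O : Finset K.ConnectedComponent := K.oddComponents.toFinset with hO
  have hOcard : O.card = K.oddComponents.ncard := by simp [hO, Set.ncard_eq_toFinset_card']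
  have hdisj : (O : Set K.ConnectedComponent).PairwiseDisjoint S := by
    intro c _ c' _ hne
    rw [Function.onFun, Finset.disjoint_left]
    intro x hx hx'
    obtain ⟨h, e⟩ := (hS _ _).1 hx
    obtain ⟨h', e'⟩ := (hS _ _).1 hx'
    exact hne (e.symm.trans e')
  have hcut : ∀ c, ∑ x ∈ S c, ∑ y ∈ (S c)ᶜ, wt x y ≤ ∑ x ∈ S c, ∑ y ∈ u.toFinset, wt x y := by
    intro c
    refine Finset.sum_le_sum fun x hx ↦ Finset.sum_le_sum_of_ne_zero fun y hy hne ↦ ?_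
    obtain ⟨h, e⟩ := (hS _ _).1 hx
    by_contra hyu
    have hyv : y ∈ ((⊤ : H.Subgraph).deleteVerts u).verts := by simpa using hyu
    refine Finset.mem_compl.1 hy ((hS _ _).2 ⟨hyv, ?_⟩)
    rw [← e]
    refine ConnectedComponent.sound (Adj.reachable ?_)
    have := (hadj x y hne).symm
    have h1 := (hverts x).1 h
    have h2 := (hverts y).1 hyv
    simp [hK, h1, h2, this]
  have htot : ∑ c ∈ O, ∑ x ∈ S c, ∑ y ∈ (S c)ᶜ, wt x y ≤ r * u.ncard := by
    calc _ ≤ ∑ c ∈ O, ∑ x ∈ S c, ∑ y ∈ u.toFinset, wt x y := Finset.sum_le_sum fun c _ ↦ hcut c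
      _ = ∑ x ∈ O.biUnion S, ∑ y ∈ u.toFinset, wt x y := (Finset.sum_biUnion hdisj).symm
      _ ≤ ∑ x, ∑ y ∈ u.toFinset, wt x y :=
        Finset.sum_le_sum_of_subset (Finset.subset_univ _)
      _ = ∑ y ∈ u.toFinset, ∑ x, wt x y := Finset.sum_comm
      _ ≤ ∑ y ∈ u.toFinset, r := Finset.sum_le_sum fun y _ ↦ hrow y
      _ = r * u.ncard := by simp [Set.ncard_eq_toFinset_card', mul_comm]
  have hdef : ∑ c ∈ O, (S c ∩ D).card ≤ D.card := by
    rw [← Finset.card_biUnion]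
    · exact Finset.card_le_card (by
        intro x hx
        obtain ⟨c, _, hc⟩ := Finset.mem_biUnion.1 hx
        exact (Finset.mem_inter.1 hc).2)
    · intro c hc c' hc' hne
      exact (hdisj hc hc' hne).mono Finset.inter_subset_left Finset.inter_subset_left
  have hmain : O.card * r ≤ r * u.ncard + k * D.card := by
    calc O.card * r = ∑ c ∈ O, r := by simp
      _ ≤ ∑ c ∈ O, (∑ x ∈ S c, ∑ y ∈ (S c)ᶜ, wt x y + k * (S c ∩ D).card) := by
        refine Finset.sum_le_sum fun c hc ↦ hodd _ ?_
        rw [hScard]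
        simpa [hO] using hc
      _ ≤ _ := by
        rw [Finset.sum_add_distrib, ← Finset.mul_sum]
        exact add_le_add htot (Nat.mul_le_mul_left _ hdef)
  have h2 : u.ncard + 2 ≤ O.card := by
    rw [hOcard]
    by_contra hlt
    have h3 : K.oddComponents.ncard = u.ncard + 1 := by omega
    rw [h3] at hpar
    grind
  nlinarith [Nat.mul_le_mul_right r h2]

variable {V : Type*} (G : SimpleGraph V) (B : Finset V)

/-- The darts of `G` starting in `B`. -/
abbrev OutDart := {p : V × V // p.1 ∈ B ∧ G.Adj p.1 p.2}

/-- The vertices of the factor gadget: the darts starting in `B`, and `a` cores for every vertex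
in `B`. -/
abbrev GadgetVert (a : ℕ) := G.OutDart B ⊕ (B × Fin a)

open Classical in
/-- Opposite darts are joined with weight `k`, a core is joined to each dart at its vertex with
weight `1`. -/
noncomputable def gadgetWeight (a k : ℕ) : G.GadgetVert B a → G.GadgetVert B a → ℕ
  | .inl d, .inl e => if e.1 = d.1.swap then k else 0
  | .inl d, .inr c => if d.1.1 = c.1 then 1 else 0
  | .inr c, .inl d => if d.1.1 = c.1 then 1 else 0
  | .inr _, .inr _ => 0

/-- The factor gadget: its perfect matchings correspond to the subgraphs of `G` induced on `B`
in which every vertex misses exactly `a` of its darts. -/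
def gadget (a k : ℕ) : SimpleGraph (G.GadgetVert B a) where
  Adj x y := G.gadgetWeight B a k x y ≠ 0
  symm := ⟨by
    rintro (d | c) (e | c') h
    · simp only [gadgetWeight, ne_eq, ite_eq_right_iff, not_forall] at h ⊢
      obtain ⟨h, hk⟩ := h
      exact ⟨by simp [h], hk⟩
    · simpa [gadgetWeight] using h
    · simpa [gadgetWeight] using h
    · simp [gadgetWeight] at h⟩
  loopless := ⟨by
    rintro (⟨⟨v, w⟩, hv, hd⟩ | c) h
    · simp only [gadgetWeight, ne_eq, ite_eq_right_iff, not_forall, Prod.swap_prod_mk,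
        Prod.mk.injEq] at h
      exact hd.ne h.1.1
    · simp [gadgetWeight] at h⟩

variable {G B} {a k r : ℕ}

open Classical in
theorem card_core_at {v : V} (hv : v ∈ B) :
    (Finset.univ.filter fun c : B × Fin a ↦ v = c.1).card = a := by
  have : (Finset.univ.filter fun c : B × Fin a ↦ v = c.1) = {⟨v, hv⟩} ×ˢ Finset.univ := by
    ext ⟨⟨x, hx⟩, i⟩
    simp [eq_comm]
  simp [this]

section Count

variable [Fintype V]

open Classical in
theorem card_outDart_filter (hreg : ∀ v : V, {u : V | G.Adj v u}.ncard = r) {X : Finset V}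
    (hX : X ⊆ B) : (Finset.univ.filter fun d : G.OutDart B ↦ d.1.1 ∈ X).card = X.card * r := by
  have h : ∀ v ∈ X,
      ((Finset.univ.filter fun d : G.OutDart B ↦ d.1.1 ∈ X).filter fun d ↦ d.1.1 = v).card = r := by
    intro v hv
    rw [← hreg v, Set.ncard_eq_toFinset_card']
    refine Finset.card_bij (fun d _ ↦ d.1.2) ?_ ?_ ?_
    · rintro ⟨⟨x, y⟩, hx, hd⟩ h
      simp only [Finset.mem_filter] at h
      obtain ⟨-, rfl⟩ := h
      simpa using hd
    · rintro ⟨⟨x, y⟩, hx, hd⟩ h ⟨⟨x', y'⟩, hx', hd'⟩ h' e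
      simp only [Finset.mem_filter] at h h' e
      simp [e, h.2, h'.2]
    · intro u hu
      exact ⟨⟨(v, u), hX hv, by simpa using hu⟩, by simpa using hv, rfl⟩
  rw [Finset.card_eq_sum_card_fiberwise (f := fun d : G.OutDart B ↦ d.1.1) (t := X)
    (fun d hd ↦ by simpa using hd), Finset.sum_congr rfl h]
  simp

open Classical in
theorem card_outDart_at (hreg : ∀ v : V, {u : V | G.Adj v u}.ncard = r) {v : V} (hv : v ∈ B) :
    (Finset.univ.filter fun d : G.OutDart B ↦ d.1.1 = v).card = r := by
  simpa using card_outDart_filter hreg (Finset.singleton_subset_iff.2 hv)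

open Classical in
theorem card_gadgetVert (hreg : ∀ v : V, {u : V | G.Adj v u}.ncard = r) :
    Fintype.card (G.GadgetVert B a) = B.card * (r + a) := by
  have h := card_outDart_filter hreg (Finset.Subset.refl B)
  rw [Finset.filter_true_of_mem fun d _ ↦ d.2.1, Finset.card_univ] at h
  rw [Fintype.card_sum, h]
  simp
  ring

open Classical in
theorem sum_gadgetWeight_le (hreg : ∀ v : V, {u : V | G.Adj v u}.ncard = r) (hr : r = a + k)
    (y : G.GadgetVert B a) : ∑ x, G.gadgetWeight B a k x y ≤ r := by
  rw [Fintype.sum_sum_type]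
  rcases y with e | c
  · simp only [gadgetWeight, Finset.sum_boole, card_core_at e.2.1, hr]
    have : ∑ d : G.OutDart B, (if e.1 = d.1.swap then k else 0) ≤ k := by
      rw [← Finset.sum_filter, Finset.sum_const, smul_eq_mul]
      refine (Nat.mul_le_mul_right k (Finset.card_le_one.2 ?_)).trans_eq (one_mul k)
      intro d hd d' hd'
      simp only [Finset.mem_filter, Finset.mem_univ, true_and] at hd hd'
      exact Subtype.ext (Prod.swap_injective (hd.symm.trans hd'))
    simp only [Nat.cast_id]
    omega
  · simp [gadgetWeight, card_outDart_at hreg c.1.2]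

open Classical in
theorem sum_gadgetWeight_boundary (C : Finset (G.GadgetVert B a)) :
    ∑ x ∈ C, ∑ y ∈ Cᶜ, G.gadgetWeight B a k x y =
      ∑ d : G.OutDart B, (Finset.univ.filter fun c : B × Fin a ↦
        d.1.1 = c.1 ∧ ¬ (.inr c ∈ C ↔ .inl d ∈ C)).card +
      ∑ d : G.OutDart B, ∑ e : G.OutDart B,
        if .inl d ∈ C ∧ .inl e ∉ C ∧ e.1 = d.1.swap then k else 0 := by
  have h : ∑ x ∈ C, ∑ y ∈ Cᶜ, G.gadgetWeight B a k x y =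
      ∑ x, ∑ y, if x ∈ C ∧ y ∉ C then G.gadgetWeight B a k x y else 0 := by
    have hx : ∀ x, (∑ y, if x ∈ C ∧ y ∉ C then G.gadgetWeight B a k x y else 0) =
        if x ∈ C then ∑ y ∈ Cᶜ, G.gadgetWeight B a k x y else 0 := by
      intro x
      by_cases hx : x ∈ C
      · simp_rw [hx, true_and, if_true, ← Finset.mem_compl]
        rw [Finset.sum_ite_mem, Finset.univ_inter]
      · simp [hx]
    simp_rw [hx]
    rw [Finset.sum_ite_mem, Finset.univ_inter]
  rw [h]
  simp only [Fintype.sum_sum_type, gadgetWeight, Finset.sum_add_distrib, ite_self,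
    Finset.sum_const_zero, add_zero, Finset.card_filter]
  rw [Finset.sum_comm (γ := B × Fin a)]
  rw [add_assoc, ← Finset.sum_add_distrib, add_comm]
  congr 1
  · refine Finset.sum_congr rfl fun d _ ↦ ?_
    rw [← Finset.sum_add_distrib]
    refine Finset.sum_congr rfl fun c _ ↦ ?_
    grind
  · refine Finset.sum_congr rfl fun d _ ↦ Finset.sum_congr rfl fun e _ ↦ ?_
    grind

open Classical in
theorem le_sum_gadgetWeight_boundary (hreg : ∀ v : V, {u : V | G.Adj v u}.ncard = r)
    (hr : r = a + k) (har : r ≤ 3 * a) (ha : Odd a) (hro : Odd r)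
    (hcut : ∀ X ⊆ B, X.Nonempty → X ≠ B →
      1 < (Finset.univ.filter fun p : V × V ↦ p.1 ∈ X ∧ p.2 ∉ X ∧ G.Adj p.1 p.2).card)
    {D : Finset (G.GadgetVert B a)} (hD : ∀ d : G.OutDart B, d.1.2 ∉ B → .inl d ∈ D)
    {c₀ : B × Fin a} (hc₀ : .inr c₀ ∈ D) (C : Finset (G.GadgetVert B a)) (hC : Odd C.card) :
    r ≤ ∑ x ∈ C, ∑ y ∈ Cᶜ, G.gadgetWeight B a k x y + k * (C ∩ D).card := by
  rw [sum_gadgetWeight_boundary]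
  by_cases hsplit : ∃ v i j, (.inr (v, i) : G.GadgetVert B a) ∈ C ∧
      (.inr (v, j) : G.GadgetVert B a) ∉ C
  · obtain ⟨v, i, j, hi, hj⟩ := hsplit
    rw [add_assoc]
    refine le_add_right ?_
    rw [← card_outDart_at hreg v.2, Finset.card_filter]
    refine Finset.sum_le_sum fun d _ ↦ ?_
    split_ifs with hd
    · refine Finset.card_pos.2 ?_
      by_cases h : .inl d ∈ C
      · exact ⟨(v, j), by simp [hd, h, hj]⟩
      · exact ⟨(v, i), by simp [hd, h, hi]⟩
    · exact Nat.zero_le _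
  push Not at hsplit
  have ha0 : 0 < a := ha.pos
  set X : Finset V := B.filter fun v ↦ ∃ h : v ∈ B, (.inr (⟨v, h⟩, ⟨0, ha0⟩) : G.GadgetVert B a) ∈ C
    with hX
  have hXB : X ⊆ B := Finset.filter_subset _ _
  have hcore : ∀ c : B × Fin a, (.inr c : G.GadgetVert B a) ∈ C ↔ c.1.1 ∈ X := by
    rintro ⟨⟨v, hv⟩, i⟩
    simp only [hX, Finset.mem_filter, hv, true_and, exists_true_left]
    exact ⟨fun h ↦ hsplit _ _ _ h, fun h ↦ hsplit _ _ _ h⟩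
  set E : Finset (G.OutDart B) := Finset.univ.filter fun d ↦ ¬ (d.1.1 ∈ X ↔ .inl d ∈ C) with hE
  have hfirst : (∑ d : G.OutDart B, (Finset.univ.filter fun c : B × Fin a ↦
      d.1.1 = c.1 ∧ ¬ (.inr c ∈ C ↔ .inl d ∈ C)).card) = E.card * a := by
    rw [hE, ← smul_eq_mul, ← Finset.sum_const, Finset.sum_filter]
    refine Finset.sum_congr rfl fun d _ ↦ ?_
    split_ifs with h
    · refine Finset.card_eq_zero.2 (Finset.eq_empty_of_forall_notMem fun c hc ↦ ?_)
      simp only [Finset.mem_filter, Finset.mem_univ, true_and, hcore] at hc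
      obtain ⟨hc, h'⟩ := hc
      rw [← hc] at h'
      exact h' h
    · refine Eq.trans (congrArg Finset.card ?_) (card_core_at (a := a) d.2.1)
      ext c
      simp only [Finset.mem_filter, Finset.mem_univ, true_and, hcore]
      refine ⟨fun h ↦ h.1, fun hc ↦ ⟨hc, ?_⟩⟩
      rwa [← hc]
  have hEodd : Odd E.card := by
    have h1 : C.card = C.toLeft.card + C.toRight.card := C.card_toLeft_add_card_toRight.symm
    have h2 : C.toRight.card = X.card * a := by
      have : C.toRight = (B.attach.filter fun v ↦ v.1 ∈ X) ×ˢ Finset.univ := by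
        ext c
        simp [hcore]
      rw [this, Finset.card_product, Finset.card_univ, Fintype.card_fin]
      congr 1
      refine Finset.card_bij (fun v _ ↦ v.1) (by simp) (by simp) ?_
      intro v hv
      exact ⟨⟨v, hXB hv⟩, by simpa using hv, rfl⟩
    have h3 := card_outDart_filter hreg hXB
    set F := Finset.univ.filter fun d : G.OutDart B ↦ d.1.1 ∈ X with hF
    have h4 : E = F \ C.toLeft ∪ C.toLeft \ F := by
      ext d
      simp only [hE, hF, Finset.mem_filter, Finset.mem_univ, true_and, Finset.mem_union,
        Finset.mem_sdiff, Finset.mem_toLeft]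
      tauto
    have h5 : E.card = (F \ C.toLeft).card + (C.toLeft \ F).card := by
      rw [h4, Finset.card_union_of_disjoint disjoint_sdiff_sdiff]
    have h6 := Finset.card_sdiff_add_card_inter F C.toLeft
    have h7 := Finset.card_sdiff_add_card_inter C.toLeft F
    rw [Finset.inter_comm] at h7
    have h8 : Even (X.card * r + X.card * a) := by
      rw [← mul_add]
      exact (hro.add_odd ha).mul_left _
    grind
  rw [hfirst]
  by_cases hE3 : 3 ≤ E.card
  · have := Nat.mul_le_mul_right a hE3
    omega
  have hE1 : E.card = 1 := by
    obtain ⟨m, hm⟩ := hEodd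
    omega
  obtain ⟨e, he⟩ := Finset.card_eq_one.1 hE1
  have hmem : ∀ d : G.OutDart B, d ≠ e → (.inl d ∈ C ↔ d.1.1 ∈ X) := by
    intro d hd
    by_contra h
    have : d ∈ E := by simp only [hE, Finset.mem_filter, Finset.mem_univ, true_and]; tauto
    rw [he] at this
    exact hd (Finset.mem_singleton.1 this)
  have he' : ¬ (e.1.1 ∈ X ↔ .inl e ∈ C) := by
    have : e ∈ E := by simp [he]
    simpa only [hE, Finset.mem_filter, Finset.mem_univ, true_and] using this
  have hslack : ∀ x, x ∈ C → x ∈ D → k ≤ k * (C ∩ D).card := fun x hx hx' ↦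
    Nat.le_mul_of_pos_right k (Finset.card_pos.2 ⟨x, Finset.mem_inter.2 ⟨hx, hx'⟩⟩)
  have hpair : ∀ d : G.OutDart B, .inl d ∈ C →
      (∀ f : G.OutDart B, f.1 = d.1.swap → .inl f ∉ C) →
      r ≤ E.card * a + (∑ d : G.OutDart B, ∑ e : G.OutDart B,
        if .inl d ∈ C ∧ .inl e ∉ C ∧ e.1 = d.1.swap then k else 0) + k * (C ∩ D).card := by
    intro d hd hf
    by_cases hdB : d.1.2 ∈ B
    · let f : G.OutDart B := ⟨d.1.swap, hdB, d.2.2.symm⟩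
      have hfC := hf f rfl
      have h1 := Finset.single_le_sum (f := fun f : G.OutDart B ↦
        if .inl d ∈ C ∧ .inl f ∉ C ∧ f.1 = d.1.swap then k else 0)
        (fun _ _ ↦ Nat.zero_le _) (Finset.mem_univ f)
      have h2 := Finset.single_le_sum (f := fun d : G.OutDart B ↦ ∑ f : G.OutDart B,
        if .inl d ∈ C ∧ .inl f ∉ C ∧ f.1 = d.1.swap then k else 0)
        (fun _ _ ↦ Nat.zero_le _) (Finset.mem_univ d)
      have h3 := h1.trans h2
      simp only [hd, hfC, not_false_eq_true, true_and] at h3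
      rw [if_pos rfl] at h3
      rw [hE1]
      omega
    · have := hslack _ hd (hD d hdB)
      rw [hE1]
      omega
  rcases X.eq_empty_or_nonempty with h0 | h0
  · have heC : .inl e ∈ C := by simpa [h0] using he'
    refine hpair e heC fun f hf hfC ↦ ?_
    have hfe : f ≠ e := by
      intro h
      rw [h] at hf
      exact e.2.2.ne (congrArg Prod.fst hf)
    simp [hmem f hfe, h0] at hfC
  by_cases hXe : X = B
  · have := hslack _ ((hcore c₀).2 (by rw [hXe]; exact c₀.1.2)) hc₀
    rw [hE1]
    omega
  obtain ⟨p, hp, q, hq, hpq⟩ := Finset.one_lt_card.1 (hcut X hXB h0 hXe)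
  have hex : ∃ p : V × V, (p.1 ∈ X ∧ p.2 ∉ X ∧ G.Adj p.1 p.2) ∧ p ≠ e.1 ∧ p.swap ≠ e.1 := by
    simp only [Finset.mem_filter, Finset.mem_univ, true_and] at hp hq
    by_contra! hcon
    have hswap : ∀ p q : V × V, p.2 ∉ X → q.1 ∈ X → q ≠ p.swap := by
      rintro p q hp hq rfl
      exact hp hq
    by_cases hpe : p = e.1
    · have hq' := hcon q hq fun h ↦ hpq (hpe.trans h.symm)
      exact hswap q p hq.2.1 hp.1 (hpe.trans hq'.symm)
    · have hp' := hcon p hp hpe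
      by_cases hqe : q = e.1
      · exact hswap p q hp.2.1 hq.1 (hqe.trans hp'.symm)
      · exact hpq (Prod.swap_injective (hp'.trans (hcon q hq hqe).symm))
  obtain ⟨p, ⟨hp1, hp2, hadj⟩, hpe, hpe'⟩ := hex
  refine hpair ⟨p, hXB hp1, hadj⟩ ((hmem _ fun h ↦ hpe (congrArg Subtype.val h)).2 hp1) ?_
  intro f hf hfC
  have hfe : f ≠ e := by
    intro h
    rw [h] at hf
    exact hpe' hf.symm
  rw [hmem f hfe, hf] at hfC
  exact hp2 hfC

end Count

open Classical in
/-- A perfect matching of the factor gadget induces a `k`-regular subgraph on `B`. -/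
theorem exists_subgraph_of_gadget_isPerfectMatching [Finite V]
    (hreg : ∀ v : V, {u : V | G.Adj v u}.ncard = r) (hr : r = a + k)
    {M : (G.gadget B a k).Subgraph} (hM : M.IsPerfectMatching) :
    ∃ H : G.Subgraph, H.verts = B ∧ ∀ v ∈ H.verts, {u : V | H.Adj v u}.ncard = k := by
  rw [Subgraph.isPerfectMatching_iff] at hM
  let H : G.Subgraph :=
    { verts := B
      Adj v u := ∃ (h : v ∈ B ∧ G.Adj v u) (h' : u ∈ B ∧ G.Adj u v),
        M.Adj (.inl ⟨(v, u), h⟩) (.inl ⟨(u, v), h'⟩)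
      adj_sub := fun ⟨h, _⟩ ↦ h.2
      edge_vert := fun ⟨h, _⟩ ↦ h.1
      symm := ⟨fun _ _ ⟨h, h', hm⟩ ↦ ⟨h', h, hm.symm⟩⟩ }
  refine ⟨H, rfl, fun v (hv : v ∈ B) ↦ ?_⟩
  have hpartner : ∀ i : Fin a, ∃ u, ∃ h : v ∈ B ∧ G.Adj v u,
      M.Adj (.inr (⟨v, hv⟩, i)) (.inl ⟨(v, u), h⟩) := by
    intro i
    obtain ⟨y, hy, -⟩ := hM (.inr (⟨v, hv⟩, i))
    have hy' : G.gadgetWeight B a k _ _ ≠ 0 := M.adj_sub hy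
    rcases y with ⟨⟨w, u⟩, hd⟩ | c
    · obtain rfl : w = v := by
        by_contra hne
        simp [gadgetWeight, hne] at hy'
      exact ⟨u, hd, hy⟩
    · simp [gadgetWeight] at hy'
  choose f hf hfM using hpartner
  have hinj : Function.Injective f := by
    intro i j hij
    have hj := hfM j
    simp only [← hij] at hj
    simpa using (hM _).unique (hfM i).symm hj.symm
  have hsplit : {u : V | G.Adj v u} = {u : V | H.Adj v u} ∪ Set.range f := by
    ext u
    simp only [Set.mem_ofPred_eq, Set.mem_union, Set.mem_range]
    constructor
    · intro hu
      obtain ⟨y, hy, -⟩ := hM (.inl ⟨(v, u), hv, hu⟩)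
      have hy' : G.gadgetWeight B a k _ _ ≠ 0 := M.adj_sub hy
      rcases y with ⟨⟨w, x⟩, hd⟩ | ⟨⟨w, hw⟩, i⟩
      · left
        simp only [gadgetWeight, Prod.swap_prod_mk, ne_eq, ite_eq_right_iff, not_forall,
          Prod.mk.injEq] at hy'
        obtain ⟨⟨rfl, rfl⟩, -⟩ := hy'
        exact ⟨⟨hv, hu⟩, hd, hy⟩
      · right
        obtain rfl : v = w := by
          by_contra hne
          simp [gadgetWeight, hne] at hy'
        have := (hM _).unique (hfM i) hy.symm
        simp only [Sum.inl.injEq, Subtype.mk.injEq, Prod.mk.injEq, true_and] at this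
        exact ⟨i, this⟩
    · rintro (h | ⟨i, rfl⟩)
      · exact h.adj_sub
      · exact (hf i).2
  have hdisj : Disjoint {u : V | H.Adj v u} (Set.range f) := by
    rw [Set.disjoint_left]
    rintro _ ⟨h, h', hm⟩ ⟨i, rfl⟩
    simpa using (hM _).unique hm (hfM i).symm
  have hcard := hreg v
  rw [hsplit, Set.ncard_union_eq hdisj (Set.toFinite _) (Set.toFinite _),
    ← Set.image_univ, Set.ncard_image_of_injective _ hinj, Set.ncard_univ, Nat.card_fin] at hcard
  omega

/-- A nonempty vertex set that is minimal among those joined to the rest by at most one edge. -/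
theorem exists_minimal_boundary [Fintype V] [Nonempty V] (G : SimpleGraph V) :
    ∃ B : Finset V, B.Nonempty ∧
      {p : V × V | p.1 ∈ B ∧ p.2 ∉ B ∧ G.Adj p.1 p.2}.ncard ≤ 1 ∧
      ∀ X ⊆ B, X.Nonempty → X ≠ B →
        1 < {p : V × V | p.1 ∈ X ∧ p.2 ∉ X ∧ G.Adj p.1 p.2}.ncard := by
  have hex : ∃ B : Finset V, B.Nonempty ∧
      {p : V × V | p.1 ∈ B ∧ p.2 ∉ B ∧ G.Adj p.1 p.2}.ncard ≤ 1 :=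
    ⟨Finset.univ, Finset.univ_nonempty, by simp⟩
  obtain ⟨B, ⟨hB, hB1⟩, hmin⟩ := WellFounded.has_min (wellFounded_lt (α := Finset V))
    {B | B.Nonempty ∧ {p : V × V | p.1 ∈ B ∧ p.2 ∉ B ∧ G.Adj p.1 p.2}.ncard ≤ 1} hex
  refine ⟨B, hB, hB1, fun X hX hX0 hne ↦ ?_⟩
  by_contra! h
  exact hmin X ⟨hX0, h⟩ (lt_of_le_of_ne hX hne)

open Classical in
/-- If `r` is odd, `k` is even and `3 * k ≤ 2 * r`, then every nonempty finite `r`-regular graph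
has a nonempty `k`-regular subgraph. -/
theorem exists_regular_subgraph_of_odd [Fintype V] [Nonempty V] (G : SimpleGraph V)
    (hr : Odd r) (hk : Even k) (hkr : 3 * k ≤ 2 * r)
    (hreg : ∀ v : V, {u : V | G.Adj v u}.ncard = r) :
    ∃ H : G.Subgraph, H.verts.Nonempty ∧ ∀ v ∈ H.verts, {u : V | H.Adj v u}.ncard = k := by
  have hr0 := hr.pos
  obtain ⟨a, rfl⟩ : ∃ a, r = a + k := ⟨r - k, by omega⟩
  have ha : Odd a := by grind
  obtain ⟨B, ⟨b, hb⟩, hB1, hBmin⟩ := exists_minimal_boundary G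
  let c₀ : B × Fin a := (⟨b, hb⟩, ⟨0, ha.pos⟩)
  let P : Finset (G.OutDart B) := Finset.univ.filter fun d ↦ d.1.2 ∉ B
  have hP : P.card ≤ 1 := by
    rw [Set.ncard_eq_toFinset_card'] at hB1
    refine (Finset.card_le_card_of_injOn (fun d ↦ d.1) ?_ Subtype.val_injective.injOn).trans hB1
    intro d hd
    simpa [P, d.2] using hd
  let D : Finset (G.GadgetVert B a) := insert (.inr c₀) (P.map Function.Embedding.inl)
  have hDcard : D.card ≤ 2 := by
    refine (Finset.card_insert_le _ _).trans ?_
    rw [Finset.card_map]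
    omega
  have hM : ∃ M : (G.gadget B a k).Subgraph, M.IsPerfectMatching := by
    refine exists_isPerfectMatching_of_weight _ (G.gadgetWeight B a k) (a + k) k D ?_
      (fun _ _ h ↦ h) (sum_gadgetWeight_le hreg rfl) ?_ ?_
    · rw [card_gadgetVert hreg]
      exact (hr.add_odd ha).mul_left _
    · have := ha.pos
      nlinarith [Nat.mul_le_mul_left k hDcard]
    · refine le_sum_gadgetWeight_boundary hreg rfl (by omega) ha hr ?_ ?_ (c₀ := c₀) ?_
      · intro X hX hX0 hne
        have := hBmin X hX hX0 hne
        rw [Set.ncard_eq_toFinset_card'] at this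
        convert this using 2
        ext
        simp
      · intro d hd
        simp [D, P, hd]
      · simp [D]
  obtain ⟨M, hM⟩ := hM
  obtain ⟨H, hH, hHk⟩ := exists_subgraph_of_gadget_isPerfectMatching hreg rfl hM
  exact ⟨H, ⟨b, by simpa [hH] using hb⟩, hHk⟩

end SimpleGraph

theorem statement18 (r k : ℕ) (hr : Odd r) (hkeven : Even k) (hk2 : 2 ≤ k)
    (hkr : (k : ℝ) ≤ 2 * (r : ℝ) / 3)
    (V : Type) [Fintype V] [Nonempty V] (G : SimpleGraph V)
    (hreg : ∀ v : V, {u : V | G.Adj v u}.ncard = r) :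
    ∃ H : G.Subgraph, H.verts.Nonempty ∧
      ∀ v ∈ H.verts, {u : V | H.Adj v u}.ncard = k := by
  have hkr' : 3 * k ≤ 2 * r := by
    have h : (3 * k : ℝ) ≤ 2 * r := by linarith
    exact_mod_cast h
  exact G.exists_regular_subgraph_of_odd hr hkeven hkr' hreg
end

section
/- Let r and k be positive odd integers with 0 < k < r. If G is a finite simple graph with at least one edge in which the degree of every vertex is divisible by r, then G contains a non-empty k-divisible subgraph. -/
/-- A graph is `k`-divisible if every vertex has degree divisible by `k`. -/
def KDivisible {V : Type*} (k : ℕ) (H : SimpleGraph V) : Prop :=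
  ∀ v : V, k ∣ {u : V | H.Adj v u}.ncard

open Finset in
/-- A form of Tutte's theorem: distribute a charge of at most `1` from every vertex to its neighbours
so that every odd set missing the clique `P` receives a charge of at least `1` from outside. -/
theorem SimpleGraph.exists_isPerfectMatching_of_charge {N : Type*} [Fintype N] [DecidableEq N]
    (Γ : SimpleGraph N) (P : Set N) (hP : Γ.IsClique P) (heven : Even (Fintype.card N))
    (c : N → N → ℚ) (hc0 : ∀ u x, 0 ≤ c u x) (hc1 : ∀ u, ∑ x, c u x ≤ 1)
    (hadj : ∀ u x, ¬ Γ.Adj u x → c u x = 0)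
    (hK : ∀ K : Finset N, Odd #K → (∀ x ∈ K, x ∉ P) → 1 ≤ ∑ u ∈ Kᶜ, ∑ x ∈ K, c u x) :
    ∃ M : Γ.Subgraph, M.IsPerfectMatching := by
  classical
  rw [SimpleGraph.tutte]
  intro U hU
  rw [SimpleGraph.IsTutteViolator] at hU
  set D := ((⊤ : Γ.Subgraph).deleteVerts U) with hD
  have hDv : D.verts = Uᶜ := by simp [hD, Set.compl_eq_univ_sdiff]
  let S : D.coe.ConnectedComponent → Finset N := fun C => (Subtype.val '' C.supp).toFinset
  have mem_S : ∀ C x, x ∈ S C ↔ ∃ h : x ∈ D.verts, D.coe.connectedComponentMk ⟨x, h⟩ = C := by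
    intro C x
    simp [S]
  have card_S : ∀ C, #(S C) = C.supp.ncard := by
    intro C
    rw [← Set.ncard_coe_finset]
    simp only [S, Set.coe_toFinset]
    exact Set.ncard_image_of_injective _ Subtype.val_injective
  have S_disj : ∀ C C' x, x ∈ S C → x ∈ S C' → C = C' := by
    intro C C' x h h'
    rw [mem_S] at h h'
    obtain ⟨_, h⟩ := h
    obtain ⟨_, h'⟩ := h'
    exact h.symm.trans h'
  have S_nbr : ∀ C u x, x ∈ S C → u ∉ S C → Γ.Adj u x → u ∈ U := by
    intro C u x hx hu ha
    by_contra hcon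
    rw [mem_S] at hx hu
    obtain ⟨hx, rfl⟩ := hx
    have hu' : u ∈ D.verts := by rw [hDv]; exact hcon
    refine hu ⟨hu', ?_⟩
    rw [SimpleGraph.ConnectedComponent.eq]
    apply SimpleGraph.Adj.reachable
    rw [hDv] at hx hu'
    simpa [hD, ha] using ⟨hu', hx⟩
  have hodd := SimpleGraph.odd_ncard_oddComponents (G := D.coe)
  have hcardD : Nat.card D.verts = Fintype.card N - U.ncard := by
    rw [hDv, Nat.card_coe_set_eq, Set.ncard_compl, Nat.card_eq_fintype_card]
  have hUle : U.ncard ≤ Fintype.card N := by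
    rw [← Nat.card_eq_fintype_card]; exact Set.ncard_le_card U
  rw [hcardD] at hodd
  let O : Finset D.coe.ConnectedComponent := D.coe.oddComponents.toFinset
  have hO : #O = D.coe.oddComponents.ncard := by
    rw [← Set.ncard_coe_finset]; simp [O]
  rw [← hO] at hU hodd
  have mem_O : ∀ C, C ∈ O ↔ Odd #(S C) := by
    intro C; simp [O, card_S]
  have key : #(O.filter fun C => ∀ x ∈ S C, x ∉ P) ≤ U.ncard := by
    set O' := O.filter fun C => ∀ x ∈ S C, x ∉ P with hO'
    have h1 : (#O' : ℚ) ≤ ∑ C ∈ O', ∑ u ∈ (S C)ᶜ, ∑ x ∈ S C, c u x := by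
      rw [← nsmul_one, ← sum_const]
      refine sum_le_sum fun C hC => ?_
      rw [hO', mem_filter, mem_O] at hC
      exact hK _ hC.1 hC.2
    have h2 : ∀ C ∈ O', ∑ u ∈ (S C)ᶜ, ∑ x ∈ S C, c u x ≤ ∑ u ∈ U.toFinset, ∑ x ∈ S C, c u x := by
      intro C _
      rw [← sum_filter_ne_zero]
      refine sum_le_sum_of_subset_of_nonneg (fun u hu => ?_)
        fun u _ _ => sum_nonneg fun x _ => hc0 u x
      rw [mem_filter] at hu
      obtain ⟨hu, hne⟩ := hu
      obtain ⟨x, hx, hx0⟩ := exists_ne_zero_of_sum_ne_zero hne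
      rw [Set.mem_toFinset]
      exact S_nbr C u x hx (by simpa using hu) (by_contra fun h => hx0 (hadj u x h))
    have h3 : ∑ C ∈ O', ∑ u ∈ U.toFinset, ∑ x ∈ S C, c u x ≤ ∑ u ∈ U.toFinset, 1 := by
      rw [sum_comm]
      refine sum_le_sum fun u _ => ?_
      rw [← sum_biUnion]
      · exact (sum_le_univ_sum_of_nonneg (hc0 u)).trans (hc1 u)
      · intro C _ C' _ hne
        rw [Function.onFun, Finset.disjoint_left]
        exact fun x hx hx' => hne (S_disj C C' x hx hx')
    have h4 : (#O' : ℚ) ≤ #U.toFinset := by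
      refine (h1.trans (sum_le_sum h2)).trans (h3.trans ?_)
      simp
    rw [Set.ncard_eq_toFinset_card']
    exact_mod_cast h4
  have key2 : #(O.filter fun C => ¬ ∀ x ∈ S C, x ∉ P) ≤ 1 := by
    rw [card_le_one]
    intro C hC C' hC'
    simp only [mem_filter, not_forall, not_not] at hC hC'
    obtain ⟨_, x, hx, hxP⟩ := hC
    obtain ⟨_, y, hy, hyP⟩ := hC'
    by_contra hne
    have hy' : y ∉ S C := fun h => hne (S_disj _ _ _ h hy)
    have hxy : y ≠ x := fun h => hy' (h ▸ hx)
    have := S_nbr C y x hx hy' (hP hyP hxP hxy)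
    rw [mem_S] at hy
    obtain ⟨hy, _⟩ := hy
    rw [hDv] at hy
    exact hy this
  have := card_filter_add_card_filter_not (s := O) (fun C => ∀ x ∈ S C, x ∉ P)
  have hO1 : #O = U.ncard + 1 := by omega
  rw [hO1, Nat.odd_iff, Nat.odd_iff] at hodd
  rw [Nat.even_iff] at heven
  omega

namespace SimpleGraph

variable {V : Type*}

/-- The gadget whose perfect matchings select `n v` darts at every vertex `v` of `G`, in such a way
that the two darts of an edge that is not a bridge are both selected or both not selected. -/
def portGraph (G : SimpleGraph V) (n : V → ℕ) : SimpleGraph (G.Dart ⊕ (Σ v, Fin (n v))) where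
  Adj
    | .inl a, .inl b => a ≠ b ∧ (b = a.symm ∨ G.IsBridge a.edge ∧ G.IsBridge b.edge)
    | .inl a, .inr q => a.fst = q.1
    | .inr q, .inl a => a.fst = q.1
    | .inr _, .inr _ => False
  symm := ⟨by
    rintro (a | p) (b | q) h
    · refine ⟨h.1.symm, ?_⟩
      rcases h.2 with rfl | h
      · simp
      · exact .inr h.symm
    · exact h
    · exact h
    · exact h⟩
  loopless := ⟨by
    rintro (a | p) h
    · exact h.1 rfl
    · exact h⟩

open Classical in
/-- The charges on `portGraph` used to verify Tutte's condition. -/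
noncomputable def portCharge (G : SimpleGraph V) (s : ℕ) (m : V → ℕ) :
    G.Dart ⊕ (Σ v, Fin (s * m v)) → G.Dart ⊕ (Σ v, Fin (s * m v)) → ℚ
  | .inl a, .inl b => if b = a.symm ∧ ¬ G.IsBridge a.edge then 2 / (s + 2) else 0
  | .inl a, .inr q => if a.fst = q.1 then
      (if G.IsBridge a.edge then 1 / (s * m a.fst) else 1 / ((s + 2) * m a.fst)) else 0
  | .inr q, .inl a => if a.fst = q.1 then 1 / ((s + 2) * m q.1) else 0
  | .inr _, .inr _ => 0

theorem portCharge_nonneg (G : SimpleGraph V) (s : ℕ) (m : V → ℕ) (u x) :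
    0 ≤ portCharge G s m u x := by
  rcases u with a | p <;> rcases x with b | q <;> simp only [portCharge] <;> positivity

theorem portCharge_eq_zero (G : SimpleGraph V) (s : ℕ) (m : V → ℕ) (u x)
    (h : ¬ (G.portGraph fun v => s * m v).Adj u x) : portCharge G s m u x = 0 := by
  rcases u with a | p <;> rcases x with b | q <;> simp only [portCharge, ite_eq_right_iff]
  · rintro ⟨rfl, _⟩
    exact absurd ⟨a.symm_ne.symm, .inl rfl⟩ h
  · exact fun hb => absurd hb h
  · exact fun hb => absurd hb h

open Finset in
theorem sum_portCharge_le [Fintype V] (G : SimpleGraph V) [Fintype G.Dart] [DecidableEq V]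
    (s : ℕ) (m : V → ℕ) (hs : 0 < s)
    (hdeg : ∀ v, #{a : G.Dart | a.fst = v} = (s + 2) * m v) (u) :
    ∑ x, portCharge G s m u x ≤ 1 := by
  classical
  rw [Fintype.sum_sum_type]
  rcases u with a | p
  · have hm : 0 < m a.fst := by
      have : 0 < #{b : G.Dart | b.fst = a.fst} := card_pos.2 ⟨a, by simp⟩
      rw [hdeg] at this
      exact pos_of_mul_pos_right this (by positivity)
    have h1 : ∑ b, portCharge G s m (.inl a) (.inl b)
        = if G.IsBridge a.edge then 0 else 2 / ((s : ℚ) + 2) := by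
      rw [sum_eq_single a.symm]
      · simp [portCharge]
      · intro b _ hb
        simp [portCharge, hb]
      · simp
    have h2 : ∑ q, portCharge G s m (.inl a) (.inr q) = s * m a.fst *
        if G.IsBridge a.edge then 1 / ((s : ℚ) * m a.fst) else 1 / ((s + 2) * m a.fst) := by
      rw [Fintype.sum_sigma, sum_eq_single a.fst]
      · simp [portCharge]
      · intro v _ hv
        simp [portCharge, hv.symm]
      · simp
    rw [h1, h2]
    split_ifs
    · apply le_of_eq; field_simp; ring
    · apply le_of_eq; field_simp; ring
  · have h1 : ∑ a, portCharge G s m (.inr p) (.inl a)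
        = ∑ a : G.Dart with a.fst = p.1, 1 / (((s : ℚ) + 2) * m p.1) := by
      rw [sum_filter]
      exact sum_congr rfl fun a _ => by simp [portCharge]
    have h2 : ∑ q, portCharge G s m (.inr p) (.inr q) = 0 := by simp [portCharge]
    rw [h1, h2, add_zero, sum_const, hdeg, nsmul_eq_mul]
    have hm : 0 < m p.1 := by
      have := p.2.pos
      exact pos_of_mul_pos_right this (by positivity)
    apply le_of_eq
    push_cast
    field_simp

open Finset in
theorem one_le_sum_portCharge [Fintype V] (G : SimpleGraph V) [Fintype G.Dart] [DecidableEq V]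
    [DecidableEq G.Dart]
    (s : ℕ) (m : V → ℕ) (hs : 0 < s)
    (hdeg : ∀ v, #{a : G.Dart | a.fst = v} = (s + 2) * m v)
    (K : Finset (G.Dart ⊕ (Σ v, Fin (s * m v)))) (hodd : Odd #K)
    (hbr : ∀ a, .inl a ∈ K → ¬ G.IsBridge a.edge) :
    1 ≤ ∑ u ∈ Kᶜ, ∑ x ∈ K, portCharge G s m u x := by
  classical
  have hm (a : G.Dart) : 0 < m a.fst := by
    have : 0 < #{b : G.Dart | b.fst = a.fst} := card_pos.2 ⟨a, by simp⟩
    rw [hdeg] at this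
    exact pos_of_mul_pos_right this (by positivity)
  set g : G.Dart ⊕ (Σ v, Fin (s * m v)) → G.Dart ⊕ (Σ v, Fin (s * m v)) → ℚ :=
    fun u x => if u ∉ K ∧ x ∈ K then portCharge G s m u x else 0 with hg
  have g0 : ∀ u x, 0 ≤ g u x := by
    intro u x
    simp only [hg]
    split_ifs
    exacts [portCharge_nonneg .., le_rfl]
  let σ : G.Dart → ℚ := fun a => g (.inl a) (.inl a.symm)
  let τ : G.Dart → ℚ := fun a =>
    ∑ i, (g (.inl a) (.inr ⟨a.fst, i⟩) + g (.inr ⟨a.fst, i⟩) (.inl a))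
  have σ0 : ∀ a, 0 ≤ σ a := fun a => g0 _ _
  have τ0 : ∀ a, 0 ≤ τ a := fun a => sum_nonneg fun i _ => add_nonneg (g0 _ _) (g0 _ _)
  have hT : ∑ a, σ a + ∑ a, τ a ≤ ∑ u ∈ Kᶜ, ∑ x ∈ K, portCharge G s m u x := by
    have h1 : ∑ u ∈ Kᶜ, ∑ x ∈ K, portCharge G s m u x = ∑ u, ∑ x, g u x := by
      simp only [hg, ite_and, sum_ite_irrel, sum_const_zero]
      rw [← sum_filter]
      refine sum_congr (by ext; simp) fun u _ => ?_
      rw [← sum_filter]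
      exact sum_congr (by ext; simp) fun _ _ => rfl
    rw [h1, Fintype.sum_sum_type]
    simp only [Fintype.sum_sum_type, sum_add_distrib]
    have h2 : ∑ a, σ a ≤ ∑ a, ∑ b, g (.inl a) (.inl b) :=
      sum_le_sum fun a _ => single_le_sum (f := fun b => g (.inl a) (.inl b))
        (fun b _ => g0 _ _) (mem_univ a.symm)
    have h3 : ∑ a, τ a ≤ ∑ a, ∑ q, g (.inl a) (.inr q) + ∑ q, ∑ a, g (.inr q) (.inl a) := by
      rw [sum_comm (s := univ (α := Σ v, Fin (s * m v))), ← sum_add_distrib]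
      refine sum_le_sum fun a _ => ?_
      rw [← sum_add_distrib, Fintype.sum_sigma]
      exact single_le_sum (f := fun v => ∑ i, (g (.inl a) (.inr ⟨v, i⟩) + g (.inr ⟨v, i⟩) (.inl a)))
        (fun v _ => sum_nonneg fun i _ => add_nonneg (g0 _ _) (g0 _ _)) (mem_univ a.fst)
    have h4 : 0 ≤ ∑ p, ∑ q, g (.inr p) (.inr q) :=
      sum_nonneg fun p _ => sum_nonneg fun q _ => g0 _ _
    linarith
  refine le_trans ?_ hT
  have hσ : 0 ≤ ∑ a, σ a := sum_nonneg fun a _ => σ0 a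
  have hs' : (0 : ℚ) < s := by exact_mod_cast hs
  by_cases hsplit : ∃ v i j, .inr ⟨v, i⟩ ∈ K ∧ .inr ⟨v, j⟩ ∉ K
  · obtain ⟨v, i, j, hi, hj⟩ := hsplit
    have hmv : 0 < m v := pos_of_mul_pos_right i.pos (by positivity)
    have hmv' : (0 : ℚ) < m v := by exact_mod_cast hmv
    have hle : ∀ a : G.Dart, a.fst = v → 1 / (((s : ℚ) + 2) * m v) ≤ τ a := by
      rintro a rfl
      by_cases ha : .inl a ∈ K
      · refine le_trans ?_ (single_le_sum (fun (i : Fin (s * m a.fst)) _ =>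
          add_nonneg (g0 _ _) (g0 _ _)) (mem_univ j))
        simp [hg, ha, hj, portCharge]
      · refine le_trans ?_ (single_le_sum (fun (i : Fin (s * m a.fst)) _ =>
          add_nonneg (g0 _ _) (g0 _ _)) (mem_univ i))
        simp only [hg, ha, hi, portCharge]
        simp only [not_true_eq_false, not_false_eq_true, and_self, if_true, if_false,
          add_zero]
        split_ifs
        · gcongr
          linarith
        · rfl
    have : ∑ a : G.Dart with a.fst = v, 1 / (((s : ℚ) + 2) * m v) ≤ ∑ a, τ a :=
      (sum_le_sum fun a ha => hle a (by simpa using ha)).trans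
        (sum_le_univ_sum_of_nonneg τ0)
    rw [sum_const, hdeg, nsmul_eq_mul] at this
    have h1 : (((s + 2) * m v : ℕ) : ℚ) * (1 / (((s : ℚ) + 2) * m v)) = 1 := by
      push_cast
      field_simp
    linarith
  push Not at hsplit
  let k : V → Prop := fun v => ∀ i, .inr ⟨v, i⟩ ∈ K
  have hk : ∀ v i, .inr ⟨v, i⟩ ∈ K ↔ k v := fun v i => ⟨fun h j => hsplit v i j h, fun h => h i⟩
  by_cases hb : ∃ a : G.Dart, G.IsBridge a.edge ∧ k a.fst
  · obtain ⟨a, hab, hka⟩ := hb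
    have haK : .inl a ∉ K := fun h => hbr a h hab
    have hma : (0 : ℚ) < m a.fst := by exact_mod_cast hm a
    have h1 : τ a = 1 := by
      simp only [τ, hg, hk, hka, haK, portCharge]
      simp [hab]
      field_simp
    have := single_le_sum (f := τ) (fun a _ => τ0 a) (mem_univ a)
    linarith
  push Not at hb
  let F : Finset G.Dart := {a | ¬ (.inl a ∈ K ↔ k a.fst)}
  have mem_F : ∀ a, a ∈ F ↔ ¬ (.inl a ∈ K ↔ k a.fst) := by simp [F]
  have hF : ∀ a ∈ F, (s : ℚ) / (s + 2) ≤ τ a := by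
    intro a ha
    rw [mem_F] at ha
    have hma : (0 : ℚ) < m a.fst := by exact_mod_cast hm a
    apply le_of_eq
    by_cases haK : .inl a ∈ K
    · have hka : ¬ k a.fst := by tauto
      simp only [τ, hg, hk, hka, haK, portCharge]
      simp
      field_simp
    · have hka : k a.fst := by tauto
      have hab : ¬ G.IsBridge a.edge := fun h => hb a h hka
      simp only [τ, hg, hk, hka, haK, portCharge]
      simp [hab]
      field_simp
  have hFodd : Odd #F := by
    have hK : #K = #{a : G.Dart | .inl a ∈ K} + #{q : (Σ v, Fin (s * m v)) | k q.1} := by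
      rw [← card_toLeft_add_card_toRight (u := K)]
      congr 2
      · ext a; simp
      · ext ⟨v, i⟩; simp [hk]
    have h1 : #{q : (Σ v, Fin (s * m v)) | k q.1} = ∑ v with k v, s * m v := by
      simp only [card_filter, Fintype.sum_sigma, sum_filter]
      refine sum_congr rfl fun v _ => ?_
      split_ifs <;> simp
    have h2 : #{a : G.Dart | k a.fst} = ∑ v with k v, (s + 2) * m v := by
      rw [card_eq_sum_card_fiberwise (f := fun a => a.fst) (t := {v | k v}) (by intro a; simp)]
      refine sum_congr rfl fun v hv => ?_
      rw [← hdeg, filter_filter]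
      congr 1
      ext a
      simp only [mem_filter, mem_univ, true_and] at hv ⊢
      constructor
      · exact fun h => h.2
      · rintro rfl
        exact ⟨hv, rfl⟩
    have h3 : #{a : G.Dart | .inl a ∈ K} + #{a : G.Dart | k a.fst}
        = #F + 2 * #{a : G.Dart | .inl a ∈ K ∧ k a.fst} := by
      simp only [F, card_filter, mul_sum, ← sum_add_distrib]
      refine sum_congr rfl fun a _ => ?_
      by_cases h : .inl a ∈ K <;> by_cases h' : k a.fst <;> simp [h, h']
    have h4 : ∑ v with k v, s * m v + ∑ v with k v, (s + 2) * m v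
        = 2 * ∑ v with k v, (s + 1) * m v := by
      rw [← sum_add_distrib, mul_sum]
      refine sum_congr rfl fun v _ => by ring
    rw [Nat.odd_iff] at hodd ⊢
    omega
  have hFsum : (#F : ℚ) * (s / (s + 2)) ≤ ∑ a, τ a := by
    rw [← nsmul_eq_mul, ← sum_const]
    exact (sum_le_sum hF).trans (sum_le_univ_sum_of_nonneg τ0)
  by_cases h3 : 3 ≤ #F
  · have h3' : (3 : ℚ) ≤ #F := by exact_mod_cast h3
    have h1 : (1 : ℚ) ≤ 3 * (s / (s + 2)) := by
      have : (1 : ℚ) ≤ s := by exact_mod_cast hs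
      rw [mul_div_assoc', le_div_iff₀ (by positivity)]
      linarith
    have h2 : 3 * ((s : ℚ) / (s + 2)) ≤ #F * (s / (s + 2)) := by gcongr
    linarith
  have hF1 : #F = 1 := by
    rw [Nat.odd_iff] at hFodd
    omega
  suffices h : ∃ b, 2 / ((s : ℚ) + 2) ≤ σ b by
    obtain ⟨b, hb⟩ := h
    have h1 := single_le_sum (f := σ) (fun a _ => σ0 a) (mem_univ b)
    rw [hF1, Nat.cast_one, one_mul] at hFsum
    have h2 : (s : ℚ) / (s + 2) + 2 / (s + 2) = 1 := by field_simp
    linarith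
  by_contra! hcon
  obtain ⟨a, hFa⟩ := card_eq_one.1 hF1
  have hsymm' : ∀ b : G.Dart, .inl b ∈ K → .inl b.symm ∈ K := by
    intro b hbK
    by_contra hbK'
    refine (hcon b.symm).not_ge ?_
    simp [σ, hg, hbK, hbK', portCharge, hbr b hbK]
  have hsymm : ∀ b : G.Dart, .inl b.symm ∈ K ↔ .inl b ∈ K := fun b =>
    ⟨fun h => by simpa using hsymm' _ h, hsymm' b⟩
  have hflip : ∀ b, b ≠ a → (.inl b ∈ K ↔ k b.fst) := by
    intro b hba
    by_contra h
    rw [← mem_F, hFa, mem_singleton] at h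
    exact hba h
  have hflipa : ¬ (.inl a ∈ K ↔ k a.fst) := by
    rw [← mem_F, hFa, mem_singleton]
  have hka : ¬ (k a.fst ↔ k a.snd) := by
    have := hflip a.symm a.symm_ne
    rw [hsymm] at this
    change _ ↔ k a.snd at this
    tauto
  have hbridge : G.IsBridge a.edge := by
    change G.IsBridge s(a.fst, a.snd)
    rw [isBridge_iff]
    rintro ⟨p⟩
    refine hka ?_
    suffices h : ∀ u w (p : (G.deleteEdges {s(a.fst, a.snd)}).Walk u w), k u ↔ k w from h _ _ p
    intro u w p
    induction p with
    | nil => rfl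
    | @cons u x _ h _ ih =>
      refine Iff.trans ?_ ih
      rw [deleteEdges_adj] at h
      obtain ⟨hux, hne⟩ := h
      let b : G.Dart := ⟨(u, x), hux⟩
      have hb1 : b ≠ a := by
        rintro h; apply hne; rw [← h]; simp [b]
      have hb2 : b.symm ≠ a := by
        rintro h; apply hne; rw [← h]; simp [b, Sym2.eq_swap]
      have e1 := hflip _ hb1
      have e2 := hflip _ hb2
      rw [hsymm] at e2
      exact e1.symm.trans e2
  have n1 := hb a hbridge
  have n2 := hb a.symm (by simpa using hbridge)
  change ¬ k a.snd at n2
  tauto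

open Finset in
/-- If `G` has degrees `(s + 2) * m v`, then `s * m v` darts can be selected at every vertex `v`
so that the two darts of each edge that is not a bridge are selected simultaneously. -/
theorem exists_dart_selection [Fintype V] [DecidableEq V] (G : SimpleGraph V)
    [Fintype G.Dart] (s : ℕ) (m : V → ℕ) (hs : 0 < s)
    (hdeg : ∀ v, #{a : G.Dart | a.fst = v} = (s + 2) * m v) :
    ∃ T : Finset G.Dart, (∀ v, #{a ∈ T | a.fst = v} = s * m v) ∧
      ∀ a ∈ T, ¬ G.IsBridge a.edge → a.symm ∈ T := by
  classical
  have heven : Even (Fintype.card (G.Dart ⊕ (Σ v, Fin (s * m v)))) := by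
    have h : Fintype.card G.Dart = ∑ v, (s + 2) * m v := by
      rw [← card_univ, card_eq_sum_card_fiberwise (f := fun a : G.Dart => a.fst) (t := univ)
        (by simp)]
      simp only [hdeg]
    rw [Fintype.card_sum, Fintype.card_sigma, h]
    simp only [Fintype.card_fin]
    rw [← sum_add_distrib]
    exact even_sum _ fun v _ => ⟨(s + 1) * m v, by ring⟩
  obtain ⟨M, hM⟩ := (G.portGraph fun v => s * m v).exists_isPerfectMatching_of_charge
    {x | ∃ a, x = .inl a ∧ G.IsBridge a.edge}
    (by
      rintro _ ⟨a, rfl, ha⟩ _ ⟨b, rfl, hb⟩ hab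
      exact ⟨fun h => hab (by rw [h]), .inr ⟨ha, hb⟩⟩)
    heven (portCharge G s m) (portCharge_nonneg G s m) (sum_portCharge_le G s m hs hdeg)
    (portCharge_eq_zero G s m)
    fun K hK hKb => one_le_sum_portCharge G s m hs hdeg K hK
      fun a ha hb => hKb _ ha ⟨a, rfl, hb⟩
  rw [Subgraph.isPerfectMatching_iff] at hM
  have hcore : ∀ q, ∃ a, M.Adj (.inr q) (.inl a) := by
    intro q
    obtain ⟨a | p, h, _⟩ := hM (.inr q)
    · exact ⟨a, h⟩
    · exact (M.adj_sub h).elim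
  choose φ hφ using hcore
  refine ⟨({a | ∃ q, M.Adj (.inl a) (.inr q)} : Finset G.Dart), fun v => ?_, fun a ha hbr => ?_⟩
  · have himg : ({a ∈ ({a | ∃ q, M.Adj (.inl a) (.inr q)} : Finset G.Dart) | a.fst = v})
        = univ.image fun i => φ ⟨v, i⟩ := by
      ext a
      simp only [mem_filter, mem_univ, true_and, mem_image]
      constructor
      · rintro ⟨⟨⟨w, i⟩, h⟩, rfl⟩
        obtain rfl : a.fst = w := M.adj_sub h
        exact ⟨i, Sum.inl_injective ((hM _).unique (hφ _) h.symm)⟩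
      · rintro ⟨i, rfl⟩
        exact ⟨⟨_, (hφ _).symm⟩, M.adj_sub (hφ ⟨v, i⟩)⟩
    rw [himg, card_image_of_injective, card_univ, Fintype.card_fin]
    intro i j hij
    have h := (hφ ⟨v, j⟩).symm
    rw [← show φ ⟨v, i⟩ = φ ⟨v, j⟩ from hij] at h
    have := Sum.inr_injective ((hM _).unique (hφ ⟨v, i⟩).symm h)
    simpa using this
  · simp only [mem_filter, mem_univ, true_and] at ha ⊢
    obtain ⟨q, hq⟩ := ha
    obtain ⟨b | p, h, _⟩ := hM (.inl a.symm)
    · rcases (M.adj_sub h).2 with rfl | ⟨h', _⟩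
      · rw [Dart.symm_symm] at h
        exact absurd ((hM _).unique hq h.symm) (by simp)
      · exact absurd (by simpa using h') hbr
    · exact ⟨p, h⟩

/-- Let `R` be a relation along the edges of `G` that is one-sided only on bridges. An `R`-step that
can be undone by a chain of `R`-steps can be undone by a single one. -/
theorem symm_of_reflTransGen (G : SimpleGraph V) (R : V → V → Prop)
    (hRG : ∀ u v, R u v → G.Adj u v) (hR : ∀ u v, R u v → ¬ G.IsBridge s(u, v) → R v u)
    {u v : V} (huv : R u v) (hvu : Relation.ReflTransGen R v u) : R v u := by
  by_contra hn
  have hb : G.IsBridge s(u, v) := by_contra fun h => hn (hR u v huv h)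
  rw [isBridge_iff] at hb
  suffices h : ∀ w, Relation.ReflTransGen R v w →
      (G.deleteEdges {s(u, v)}).Reachable v w from hb (h u hvu).symm
  intro w hw
  induction hw with
  | refl => rfl
  | @tail x y _ hxy ih =>
    by_cases he : s(x, y) = s(u, v)
    · rw [Sym2.eq_iff] at he
      rcases he with ⟨rfl, rfl⟩ | ⟨rfl, rfl⟩
      · exact absurd ih.symm hb
      · exact absurd hxy hn
    · exact ih.trans (Adj.reachable (deleteEdges_adj.2 ⟨hRG _ _ hxy, he⟩))

end SimpleGraph

open Finset in
/-- From degrees divisible by `s + 2` one gets a nonempty subgraph with degrees divisible by `s`. -/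
theorem KDivisible.exists_of_add_two {V : Type*} [Fintype V] {s : ℕ} (hs : 0 < s)
    {G : SimpleGraph V} (hG : G ≠ ⊥) (hdiv : KDivisible (s + 2) G) :
    ∃ H ≤ G, H ≠ ⊥ ∧ KDivisible s H := by
  classical
  choose m hm using hdiv
  have hdeg : ∀ v, #{a : G.Dart | a.fst = v} = (s + 2) * m v := by
    intro v
    rw [G.dart_fst_fiber_card_eq_degree, ← hm, ← G.card_neighborSet_eq_degree,
      ← Nat.card_eq_fintype_card]
    rfl
  obtain ⟨T, hT, hTs⟩ := G.exists_dart_selection s m hs hdeg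
  let R : V → V → Prop := fun u v => ∃ h : G.Adj u v, ⟨(u, v), h⟩ ∈ T
  have hRG : ∀ u v, R u v → G.Adj u v := fun _ _ h => h.1
  have hR : ∀ u v, R u v → ¬ G.IsBridge s(u, v) → R v u :=
    fun u v ⟨h, hT⟩ hb => ⟨h.symm, hTs _ hT hb⟩
  have hcard : ∀ v, {u | R v u}.ncard = s * m v := by
    intro v
    rw [← hT, ← Set.ncard_coe_finset]
    refine (Set.ncard_congr (fun a _ => a.snd) ?_ ?_ ?_).symm
    · rintro ⟨⟨x, y⟩, h⟩ ha
      simp only [coe_filter, Set.mem_ofPred_eq] at ha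
      obtain ⟨ha, rfl⟩ := ha
      exact ⟨h, ha⟩
    · rintro ⟨⟨x, y⟩, h⟩ ⟨⟨x', y'⟩, h'⟩ ha ha' hyy
      simp only [coe_filter, Set.mem_ofPred_eq] at ha ha' hyy
      obtain ⟨_, rfl⟩ := ha
      obtain ⟨_, rfl⟩ := ha'
      subst hyy
      rfl
    · rintro u ⟨h, hu⟩
      exact ⟨⟨(v, u), h⟩, by simpa using hu, rfl⟩
  have hpos : ∀ v u, G.Adj v u → 0 < m v := by
    intro v u h
    have : 0 < #{a : G.Dart | a.fst = v} := card_pos.2 ⟨⟨(v, u), h⟩, by simp⟩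
    rw [hdeg] at this
    exact pos_of_mul_pos_right this (by positivity)
  let W : V → Finset V := fun v => {w | Relation.ReflTransGen R v w}
  obtain ⟨x, y, hxy⟩ := SimpleGraph.ne_bot_iff_exists_adj.1 hG
  obtain ⟨v, hv, hmin⟩ := exists_min_image ({v | 0 < m v} : Finset V) (fun v => #(W v))
    ⟨x, by simpa using hpos x y hxy⟩
  simp only [mem_filter, mem_univ, true_and] at hv hmin
  have hstep : ∀ u w, R u w → 0 < m w := fun u w h => hpos w u (hRG _ _ h).symm
  have hreach : ∀ w, Relation.ReflTransGen R v w → 0 < m w := by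
    intro w h
    rcases h.cases_tail with rfl | ⟨u, _, h⟩
    exacts [hv, hstep u w h]
  have hback : ∀ w, Relation.ReflTransGen R v w → Relation.ReflTransGen R w v := by
    intro w hw
    have hsub : W w ⊆ W v := by
      intro z hz
      simp only [W, mem_filter, mem_univ, true_and] at hz ⊢
      exact hw.trans hz
    have heq := eq_of_subset_of_card_le hsub (hmin w (hreach w hw))
    have : v ∈ W w := by
      rw [heq]
      simp [W, Relation.ReflTransGen.refl]
    simpa [W] using this
  have hsymm : ∀ u w, Relation.ReflTransGen R v u → R u w → R w u := fun u w hu huw =>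
    G.symm_of_reflTransGen R hRG hR huw ((hback w (hu.tail huw)).trans hu)
  let H : SimpleGraph V :=
    { Adj := fun u w => Relation.ReflTransGen R v u ∧ R u w
      symm := ⟨fun u w h => ⟨h.1.tail h.2, hsymm u w h.1 h.2⟩⟩
      loopless := ⟨fun u h => G.irrefl (hRG _ _ h.2)⟩ }
  refine ⟨H, fun u w h => hRG _ _ h.2, ?_, fun u => ?_⟩
  · have : 0 < {u | R v u}.ncard := by
      rw [hcard]
      positivity
    obtain ⟨u, hu⟩ := (Set.ncard_pos).1 this
    exact SimpleGraph.ne_bot_iff_exists_adj.2 ⟨v, u, .refl, hu⟩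
  · by_cases hu : Relation.ReflTransGen R v u
    · have : {w | H.Adj u w} = {w | R u w} := by
        ext w
        simp [H, hu]
      rw [this, hcard]
      exact dvd_mul_right _ _
    · have : {w | H.Adj u w} = ∅ := by
        ext w
        simp [H, hu]
      simp [this]

/-- Iterating `KDivisible.exists_of_add_two`. -/
theorem KDivisible.exists_of_add_two_mul {V : Type*} [Fintype V] {k : ℕ} (hk : 0 < k) (t : ℕ)
    {G : SimpleGraph V} (hG : G ≠ ⊥) (hdiv : KDivisible (k + 2 * t) G) :
    ∃ H ≤ G, H ≠ ⊥ ∧ KDivisible k H := by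
  induction t generalizing G with
  | zero => exact ⟨G, le_rfl, hG, hdiv⟩
  | succ t ih =>
    obtain ⟨H, hHG, hH, hdivH⟩ :=
      KDivisible.exists_of_add_two (s := k + 2 * t) (by positivity) hG hdiv
    obtain ⟨H', hH'H, h⟩ := ih hH hdivH
    exact ⟨H', hH'H.trans hHG, h⟩

theorem statement19 (r k : ℕ) (hr : Odd r) (hk : Odd k) (hk0 : 0 < k) (hkr : k < r)
    (V : Type) [Fintype V] (G : SimpleGraph V)
    (hE : G.edgeSet.Nonempty) (hdiv : KDivisible r G) :
    ∃ H : SimpleGraph V, H ≤ G ∧ H ≠ ⊥ ∧ KDivisible k H := by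
  obtain ⟨t, rfl⟩ : ∃ t, r = k + 2 * t := by
    obtain ⟨a, rfl⟩ := hr
    obtain ⟨b, rfl⟩ := hk
    exact ⟨a - b, by omega⟩
  exact KDivisible.exists_of_add_two_mul hk0 t (SimpleGraph.edgeSet_nonempty.1 hE) hdiv
end
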